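/- arXiv:1911.05883 — 5 statements merged into one kernel-verified Lean document; each statement's English description precedes it below -/
import Mathlib

section
/- Let m, n be positive integers, let x > 0, and let μ_{ij} > 0 for 1 ≤ i ≤ m, 1 ≤ j ≤ n. Set ν_i = ∑_{j=1}^n μ_{ij} and τ_j = ∑_{i=1}^m μ_{ij}. Then ∑_{i=1}^m 1/(e^{x/ν_i} − 1) + ∑_{j=1}^n 1/(e^{x/τ_j} − 1) ≥ 2 ∑_{i=1}^m ∑_{j=1}^n 1/(e^{x/μ_{ij}} − 1). -/
open Finset

/-- A chord bound for the exponential, from convexity between `0` and `x / t`. -/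
lemma exp_div_sub_one_le {x t S : ℝ} (ht : 0 < t) (hS : t ≤ S) :
    Real.exp (x / S) - 1 ≤ t / S * (Real.exp (x / t) - 1) := by
  have hS0 : 0 < S := ht.trans_le hS
  have h := convexOn_exp.2 (Set.mem_univ (x / t)) (Set.mem_univ 0)
    (div_pos ht hS0).le (sub_nonneg.2 ((div_le_one hS0).2 hS)) (add_sub_cancel _ _)
  simp only [smul_eq_mul, mul_zero, add_zero, Real.exp_zero, mul_one] at h
  have he : t / S * (x / t) = x / S := by field_simp
  rw [he] at h
  linarith

lemma exp_div_sub_one_pos {x t : ℝ} (hx : 0 < x) (ht : 0 < t) :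
    0 < Real.exp (x / t) - 1 :=
  sub_pos.2 (Real.one_lt_exp_iff.2 (div_pos hx ht))

/-- The function `t ↦ 1 / (exp (x / t) - 1)` is superadditive on the positive reals. -/
lemma sum_one_div_exp_div_sub_one_le {ι : Type*} [Fintype ι] [Nonempty ι] {x : ℝ}
    (hx : 0 < x) (a : ι → ℝ) (ha : ∀ i, 0 < a i) :
    ∑ i, 1 / (Real.exp (x / a i) - 1) ≤ 1 / (Real.exp (x / ∑ i, a i) - 1) := by
  have hS : 0 < ∑ i, a i := sum_pos (fun i _ => ha i) univ_nonempty
  have hE := exp_div_sub_one_pos hx hS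
  calc ∑ i, 1 / (Real.exp (x / a i) - 1)
      ≤ ∑ i, a i / (∑ k, a k) * (1 / (Real.exp (x / ∑ k, a k) - 1)) := by
        refine sum_le_sum fun i _ => ?_
        rw [mul_one_div, div_le_div_iff₀ (exp_div_sub_one_pos hx (ha i)) hE, one_mul]
        exact exp_div_sub_one_le (ha i)
          (single_le_sum (fun k _ => (ha k).le) (mem_univ i))
    _ = 1 / (Real.exp (x / ∑ k, a k) - 1) := by
        rw [← sum_mul, ← sum_div, div_self hS.ne', one_mul]

theorem ratio_gamma_exp_sum_inequality (m n : ℕ) (hm : 0 < m) (hn : 0 < n)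
    (x : ℝ) (hx : 0 < x) (μ : Fin m → Fin n → ℝ) (hμ : ∀ i j, 0 < μ i j) :
    2 * ∑ i : Fin m, ∑ j : Fin n, 1 / (Real.exp (x / μ i j) - 1) ≤
      (∑ i : Fin m, 1 / (Real.exp (x / ∑ j : Fin n, μ i j) - 1)) +
      ∑ j : Fin n, 1 / (Real.exp (x / ∑ i : Fin m, μ i j) - 1) := by
  have : Nonempty (Fin m) := ⟨⟨0, hm⟩⟩
  have : Nonempty (Fin n) := ⟨⟨0, hn⟩⟩
  rw [two_mul]
  refine add_le_add
    (sum_le_sum fun i _ => sum_one_div_exp_div_sub_one_le hx (μ i) (hμ i)) ?_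
  rw [sum_comm]
  exact sum_le_sum fun j _ =>
    sum_one_div_exp_div_sub_one_le hx (fun i => μ i j) fun i => hμ i j
end

section
/- Let m, n be positive integers, λ_{ij} > 0 for 1 ≤ i ≤ m, 1 ≤ j ≤ n, α_i = ∑_{j=1}^n λ_{ij}, β_j = ∑_{i=1}^m λ_{ij}, and let ρ ≤ 2 be a real number. Then the second derivative of t ↦ ln f(t), where f(t) = [∏_{i=1}^m Γ(1+α_i t) · ∏_{j=1}^n Γ(1+β_j t)] / [∏_{i=1}^m ∏_{j=1}^n Γ(1+λ_{ij} t)]^ρ, is completely monotonic on (0, ∞): for every integer k ≥ 0 and every t > 0, (−1)^k · (d^k/dt^k)[(ln f)''(t)] ≥ 0. -/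
open Finset

section

open Real Set Filter Topology MeasureTheory

/-- The series `∑ 1 / (t + (k + 1) / a) ^ (p + 2)`; for `p = 0` it equals `a ^ 2 * ψ' (1 + a * t)`,
the second derivative of `t ↦ log Γ(1 + a * t)`. -/
noncomputable def gammaPoleSum (p : ℕ) (a t : ℝ) : ℝ :=
  ∑' k : ℕ, ((t + (k + 1) / a) ^ (p + 2))⁻¹

lemma summable_inv_pow_succ_div (p : ℕ) (a : ℝ) :
    Summable fun k : ℕ => ((((k : ℝ) + 1) / a) ^ (p + 2))⁻¹ := by
  have h : Summable fun k : ℕ => (((k : ℝ)) ^ (p + 2))⁻¹ :=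
    Real.summable_nat_pow_inv.2 (by omega)
  have h' := ((summable_nat_add_iff 1).2 h).mul_left (a ^ (p + 2))
  refine h'.congr fun k => ?_
  push_cast
  rw [div_pow, inv_div, div_eq_mul_inv]

lemma inv_pow_add_le (p : ℕ) {c t : ℝ} (hc : 0 < c) (ht : 0 ≤ t) :
    ((t + c) ^ p)⁻¹ ≤ (c ^ p)⁻¹ := by
  gcongr
  linarith

lemma summable_gammaPoleSum (p : ℕ) {a t : ℝ} (ha : 0 < a) (ht : 0 ≤ t) :
    Summable fun k : ℕ => ((t + ((k : ℝ) + 1) / a) ^ (p + 2))⁻¹ :=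
  (summable_inv_pow_succ_div p a).of_nonneg_of_le (fun k => by positivity)
    fun k => inv_pow_add_le _ (by positivity) ht

lemma gammaPoleSum_pos (p : ℕ) {a t : ℝ} (ha : 0 < a) (ht : 0 ≤ t) : 0 < gammaPoleSum p a t :=
  (summable_gammaPoleSum p ha ht).tsum_pos (fun k => by positivity) 0 (by positivity)

lemma hasDerivAt_gammaPoleSum (p : ℕ) {a t : ℝ} (ha : 0 < a) (ht : 0 < t) :
    HasDerivAt (gammaPoleSum p a) (-(p + 2) * gammaPoleSum (p + 1) a t) t := by
  unfold gammaPoleSum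
  rw [← tsum_mul_left]
  refine hasDerivAt_tsum_of_isPreconnected
    (g := fun k s => ((s + ((k : ℝ) + 1) / a) ^ (p + 2))⁻¹)
    (g' := fun k s => -((p : ℝ) + 2) * ((s + ((k : ℝ) + 1) / a) ^ (p + 1 + 2))⁻¹)
    (t := Ioi 0)
    (u := fun k : ℕ => ((p : ℝ) + 2) * ((((k : ℝ) + 1) / a) ^ (p + 1 + 2))⁻¹)
    ((summable_inv_pow_succ_div (p + 1) a).mul_left _)
    isOpen_Ioi isPreconnected_Ioi (fun k y hy => ?_) (fun k y hy => ?_)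
    (y₀ := t) ht ?_ ht
  · have hy' : (0 : ℝ) < y := hy
    have hpos : 0 < y + ((k : ℝ) + 1) / a := by positivity
    refine (((hasDerivAt_id' y).add_const (((k : ℝ) + 1) / a)).fun_pow (p + 2)).fun_inv
      (by positivity) |>.congr_deriv ?_
    rw [show p + 2 - 1 = p + 1 by omega]
    push_cast
    field_simp
    ring
  · have hy' : (0 : ℝ) < y := hy
    have hpos : 0 < y + ((k : ℝ) + 1) / a := by positivity
    rw [norm_mul, norm_neg, Real.norm_of_nonneg (by positivity), Real.norm_of_nonneg (by positivity)]
    exact mul_le_mul_of_nonneg_left (inv_pow_add_le _ (by positivity) hy'.le) (by positivity)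
  · exact summable_gammaPoleSum p ha ht.le

lemma hasSum_exp_neg_succ_mul {x : ℝ} (hx : 0 < x) :
    HasSum (fun k : ℕ => exp (-(((k : ℝ) + 1) * x))) (exp x - 1)⁻¹ := by
  have hq : exp (-x) < 1 := exp_lt_one_iff.mpr (by linarith)
  have h := (hasSum_geometric_of_lt_one (exp_pos (-x)).le hq).mul_left (exp (-x))
  convert! h using 1
  · ext k
    rw [← exp_nat_mul, ← exp_add]
    ring_nf
  · have : 1 < exp x := one_lt_exp_iff.2 hx
    rw [exp_neg, ← mul_inv, inv_inj, mul_sub, mul_inv_cancel₀ (exp_pos x).ne', mul_one]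

lemma mul_inv_exp_div_sub_one_le {a b u : ℝ} (ha : 0 < a) (hab : a ≤ b) (hu : 0 < u) :
    b * (exp (u / a) - 1)⁻¹ ≤ a * (exp (u / b) - 1)⁻¹ := by
  have hb : 0 < b := ha.trans_le hab
  have h1 : 1 < exp (u / a) := one_lt_exp_iff.2 (by positivity)
  have h2 : 1 < exp (u / b) := one_lt_exp_iff.2 (by positivity)
  have hc := convexOn_exp.2 (mem_univ (u / a)) (mem_univ 0) (show 0 ≤ a / b by positivity)
    (sub_nonneg.2 ((div_le_one hb).2 hab)) (add_sub_cancel _ _)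
  have he : a / b * (u / a) = u / b := by field_simp
  simp only [smul_eq_mul, mul_zero, add_zero, exp_zero, mul_one, he] at hc
  rw [← div_eq_mul_inv, ← div_eq_mul_inv, div_le_div_iff₀ (by linarith) (by linarith)]
  have : b * (a / b) = a := by field_simp
  nlinarith

lemma integral_rpow_mul_exp_neg_mul_div_exp_sub_one (p : ℕ) {a t : ℝ} (ha : 0 < a) (ht : 0 < t) :
    ∫ u in Ioi (0 : ℝ), u ^ ((p : ℝ) + 2 - 1) * exp (-(t * u)) * (exp (u / a) - 1)⁻¹ =
      gammaPoleSum p a t * Gamma (p + 2) := by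
  have hG : 0 < Gamma ((p : ℝ) + 2) := Gamma_pos_of_pos (by positivity)
  have hI : ∀ k : ℕ, ∫ u in Ioi (0 : ℝ), u ^ ((p : ℝ) + 2 - 1) * exp (-((t + (k + 1) / a) * u)) =
      ((t + (k + 1) / a) ^ (p + 2))⁻¹ * Gamma (p + 2) := fun k => by
    rw [integral_rpow_mul_exp_neg_mul_Ioi (by positivity) (by positivity), one_div,
      inv_rpow (by positivity)]
    congr 2
    exact_mod_cast rpow_natCast _ (p + 2)
  have hint : ∀ k : ℕ, Integrable (fun u : ℝ => u ^ ((p : ℝ) + 2 - 1) *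
      exp (-((t + (k + 1) / a) * u))) (volume.restrict (Ioi 0)) := fun k => by
    refine not_imp_comm.1 integral_undef ?_
    rw [hI]
    positivity
  have hS : HasSum (fun k : ℕ => ((t + ((k : ℝ) + 1) / a) ^ (p + 2))⁻¹ * Gamma (p + 2))
      (gammaPoleSum p a t * Gamma (p + 2)) :=
    (summable_gammaPoleSum p ha ht.le).hasSum.mul_right _
  have hsum := hasSum_integral_of_summable_integral_norm hint (by
    refine hS.summable.congr fun k => ?_
    rw [← hI]
    refine setIntegral_congr_fun measurableSet_Ioi fun u hu => ?_
    have hu' : (0 : ℝ) < u := hu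
    exact (Real.norm_of_nonneg (by positivity)).symm)
  simp only [hI] at hsum
  rw [hS.unique hsum]
  refine setIntegral_congr_fun measurableSet_Ioi fun u hu => ?_
  have hu' : (0 : ℝ) < u := hu
  refine (HasSum.tsum_eq ?_).symm
  convert! (hasSum_exp_neg_succ_mul (div_pos hu' ha)).mul_left
    (u ^ ((p : ℝ) + 2 - 1) * exp (-(t * u))) using 2 with k
  rw [mul_assoc, ← exp_add]
  ring_nf

lemma mul_gammaPoleSum_le (p : ℕ) {a b t : ℝ} (ha : 0 < a) (hab : a ≤ b) (ht : 0 < t) :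
    b * gammaPoleSum p a t ≤ a * gammaPoleSum p b t := by
  have hb : 0 < b := ha.trans_le hab
  have hG : 0 < Gamma ((p : ℝ) + 2) := Gamma_pos_of_pos (by positivity)
  refine le_of_mul_le_mul_right ?_ hG
  rw [mul_assoc, mul_assoc, ← integral_rpow_mul_exp_neg_mul_div_exp_sub_one p ha ht,
    ← integral_rpow_mul_exp_neg_mul_div_exp_sub_one p hb ht, ← integral_const_mul,
    ← integral_const_mul]
  refine integral_mono_of_nonneg ?_ (Integrable.const_mul ?_ _) ?_
  · filter_upwards [ae_restrict_mem measurableSet_Ioi] with u hu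
    have hu' : (0 : ℝ) < u := hu
    have : 0 < exp (u / a) - 1 := sub_pos.2 (one_lt_exp_iff.2 (by positivity))
    simp only [Pi.zero_apply]
    positivity
  · refine not_imp_comm.1 integral_undef ?_
    rw [integral_rpow_mul_exp_neg_mul_div_exp_sub_one p hb ht]
    exact (mul_pos (gammaPoleSum_pos p hb ht.le) hG).ne'
  · filter_upwards [ae_restrict_mem measurableSet_Ioi] with u hu
    have hu' : (0 : ℝ) < u := hu
    have h := mul_le_mul_of_nonneg_left (mul_inv_exp_div_sub_one_le ha hab hu')
      (show 0 ≤ u ^ ((p : ℝ) + 2 - 1) * exp (-(t * u)) by positivity)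
    linarith

/-- The function `a ↦ gammaPoleSum p a t` is superadditive. -/
lemma sum_gammaPoleSum_le {ι : Type*} [Fintype ι] [Nonempty ι] (p : ℕ) {w : ι → ℝ}
    (hw : ∀ i, 0 < w i) {t : ℝ} (ht : 0 < t) :
    ∑ i, gammaPoleSum p (w i) t ≤ gammaPoleSum p (∑ i, w i) t := by
  have hpos : 0 < ∑ i, w i := Finset.sum_pos (fun i _ => hw i) Finset.univ_nonempty
  refine le_of_mul_le_mul_left ?_ hpos
  rw [Finset.mul_sum, Finset.sum_mul]
  exact Finset.sum_le_sum fun i _ => mul_gammaPoleSum_le p (hw i)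
    (Finset.single_le_sum (fun j _ => (hw j).le) (Finset.mem_univ i)) ht

lemma sub_log_one_add_nonneg {y : ℝ} (hy : 0 ≤ y) : 0 ≤ y - log (1 + y) := by
  have := log_le_sub_one_of_pos (show 0 < 1 + y by linarith)
  linarith

lemma sub_log_one_add_le_sq {y : ℝ} (hy : 0 ≤ y) : y - log (1 + y) ≤ y ^ 2 := by
  have h1 : 0 < 1 + y := by linarith
  have h := one_sub_inv_le_log_of_pos h1
  have : y - (1 - (1 + y)⁻¹) ≤ y ^ 2 := by
    rw [← sub_nonneg]
    have : y ^ 2 - (y - (1 - (1 + y)⁻¹)) = y ^ 3 / (1 + y) := by field_simp; ring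
    rw [this]; positivity
  linarith

lemma summable_sub_log_one_add {x : ℝ} (hx : 0 ≤ x) :
    Summable fun k : ℕ => x / ((k : ℝ) + 1) - log (1 + x / (k + 1)) := by
  refine ((summable_inv_pow_succ_div 0 1).mul_left (x ^ 2)).of_nonneg_of_le
    (fun k => sub_log_one_add_nonneg (by positivity))
    fun k => (sub_log_one_add_le_sq (by positivity)).trans_eq ?_
  rw [zero_add, div_one, div_pow, div_eq_mul_inv]

/-- The logarithm of the Weierstrass product for the Gamma function. -/
lemma log_Gamma_one_add {x : ℝ} (hx : 0 < x) :
    log (Gamma (1 + x)) = -eulerMascheroniConstant * x +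
      ∑' k : ℕ, (x / ((k : ℝ) + 1) - log (1 + x / (k + 1))) := by
  have h1 := (BohrMollerup.tendsto_log_gamma hx).add_const (log x)
  have h2 : Tendsto (fun n : ℕ => -((harmonic n : ℝ) - log n) * x +
      ∑ k ∈ Finset.range n, (x / ((k : ℝ) + 1) - log (1 + x / (k + 1)))) atTop
      (𝓝 (-eulerMascheroniConstant * x +
        ∑' k : ℕ, (x / ((k : ℝ) + 1) - log (1 + x / (k + 1))))) :=
    (tendsto_harmonic_sub_log.neg.mul_const x).add
      (summable_sub_log_one_add hx.le).hasSum.tendsto_sum_nat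
  rw [add_comm 1 x, Gamma_add_one hx.ne', log_mul hx.ne' (Gamma_pos_of_pos hx).ne', add_comm (log x)]
  refine tendsto_nhds_unique (h1.congr fun n => ?_) h2
  have hfac : ∀ n : ℕ, log (n.factorial : ℝ) = ∑ k ∈ Finset.range n, log ((k : ℝ) + 1) := fun n => by
    rw [← Finset.prod_range_add_one_eq_factorial, Nat.cast_prod, log_prod]
    · simp
    · intro k _
      positivity
  have hH : (harmonic n : ℝ) * x = ∑ k ∈ Finset.range n, x / ((k : ℝ) + 1) := by
    simp only [harmonic, Rat.cast_sum, Finset.sum_mul]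
    refine Finset.sum_congr rfl fun k _ => ?_
    push_cast
    rw [div_eq_inv_mul]
  have hlog : ∀ k : ℕ, log (1 + x / ((k : ℝ) + 1)) = log (x + (k + 1)) - log ((k : ℝ) + 1) :=
    fun k => by
      rw [← log_div (by positivity) (by positivity)]
      congr 1
      field_simp
      ring
  rw [BohrMollerup.logGammaSeq, Finset.sum_range_succ', hfac, Finset.sum_sub_distrib, ← hH]
  simp only [hlog, Finset.sum_sub_distrib]
  push_cast
  rw [add_zero]
  ring

lemma norm_inv_sub_inv_add_le {c y : ℝ} (hc : 0 < c) (hy : 0 ≤ y) :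
    ‖c⁻¹ - (y + c)⁻¹‖ ≤ y * (c ^ 2)⁻¹ := by
  have h : c⁻¹ - (y + c)⁻¹ = y * (c * (y + c))⁻¹ := by
    field_simp
    ring
  rw [h, Real.norm_of_nonneg (by positivity)]
  gcongr
  nlinarith

lemma hasDerivAt_log_Gamma_one_add_mul {a t : ℝ} (ha : 0 < a) (ht : 0 < t) :
    HasDerivAt (fun s => log (Gamma (1 + a * s)))
      (-eulerMascheroniConstant * a +
        ∑' k : ℕ, ((((k : ℝ) + 1) / a)⁻¹ - (t + ((k : ℝ) + 1) / a)⁻¹)) t := by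
  have hS : HasDerivAt (fun s => ∑' k : ℕ, (a * s / ((k : ℝ) + 1) - log (1 + a * s / (k + 1))))
      (∑' k : ℕ, ((((k : ℝ) + 1) / a)⁻¹ - (t + ((k : ℝ) + 1) / a)⁻¹)) t := by
    refine hasDerivAt_tsum_of_isPreconnected
      (g := fun k s => a * s / ((k : ℝ) + 1) - log (1 + a * s / (k + 1)))
      (g' := fun k s => (((k : ℝ) + 1) / a)⁻¹ - (s + ((k : ℝ) + 1) / a)⁻¹)
      (t := Ioo 0 (t + 1))
      (u := fun k : ℕ => (t + 1) * ((((k : ℝ) + 1) / a) ^ (0 + 2))⁻¹)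
      ((summable_inv_pow_succ_div 0 a).mul_left _)
      isOpen_Ioo isPreconnected_Ioo (fun k y hy => ?_) (fun k y hy => ?_)
      (y₀ := t) ⟨ht, lt_add_one t⟩ ?_ ⟨ht, lt_add_one t⟩
    · have hy' : 0 < y := hy.1
      have h1 : HasDerivAt (fun s : ℝ => a * s / ((k : ℝ) + 1)) (a * 1 / ((k : ℝ) + 1)) y :=
        ((hasDerivAt_id' y).const_mul a).div_const _
      refine (h1.fun_sub ((h1.const_add 1).log (by positivity))).congr_deriv ?_
      field_simp
      ring
    · have hy' : 0 < y := hy.1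
      refine (norm_inv_sub_inv_add_le (by positivity) hy'.le).trans ?_
      gcongr
      exact hy.2.le
    · exact summable_sub_log_one_add (by positivity)
  refine (((hasDerivAt_id' t).const_mul (-eulerMascheroniConstant * a)).fun_add hS).congr_of_eventuallyEq
    ?_ |>.congr_deriv (by ring)
  filter_upwards [Ioi_mem_nhds ht] with s hs
  have hs' : 0 < s := hs
  rw [log_Gamma_one_add (by positivity)]
  ring

lemma hasDerivAt_deriv_log_Gamma_one_add_mul {a t : ℝ} (ha : 0 < a) (ht : 0 < t) :
    HasDerivAt (deriv fun s => log (Gamma (1 + a * s))) (gammaPoleSum 0 a t) t := by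
  have hS : HasDerivAt (fun s => ∑' k : ℕ, ((((k : ℝ) + 1) / a)⁻¹ - (s + ((k : ℝ) + 1) / a)⁻¹))
      (gammaPoleSum 0 a t) t := by
    refine hasDerivAt_tsum_of_isPreconnected
      (g := fun k s => (((k : ℝ) + 1) / a)⁻¹ - (s + ((k : ℝ) + 1) / a)⁻¹)
      (g' := fun k s => ((s + ((k : ℝ) + 1) / a) ^ (0 + 2))⁻¹)
      (t := Ioi 0)
      (u := fun k : ℕ => ((((k : ℝ) + 1) / a) ^ (0 + 2))⁻¹) (summable_inv_pow_succ_div 0 a)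
      isOpen_Ioi isPreconnected_Ioi (fun k y hy => ?_) (fun k y hy => ?_)
      (y₀ := t) ht ?_ ht
    · have hy' : 0 < y := hy
      have hpos : 0 < y + ((k : ℝ) + 1) / a := by positivity
      refine (((hasDerivAt_id' y).add_const (((k : ℝ) + 1) / a)).fun_inv hpos.ne').const_sub
        ((((k : ℝ) + 1) / a)⁻¹) |>.congr_deriv ?_
      rw [neg_div, neg_neg, one_div]
    · have hy' : 0 < y := hy
      rw [Real.norm_of_nonneg (by positivity)]
      exact inv_pow_add_le _ (by positivity) hy'.le
    · exact .of_norm_bounded ((summable_inv_pow_succ_div 0 a).mul_left t)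
        fun k => norm_inv_sub_inv_add_le (by positivity) ht.le
  refine (hS.const_add (-eulerMascheroniConstant * a)).congr_of_eventuallyEq ?_
  filter_upwards [Ioi_mem_nhds ht] with s hs
  exact (hasDerivAt_log_Gamma_one_add_mul ha hs).deriv

end

open Set Filter Topology

theorem completely_monotonic_second_deriv_log_ratio_gamma
    (m n : ℕ) (hm : 0 < m) (hn : 0 < n)
    (lam : Fin m → Fin n → ℝ) (hlam : ∀ i j, 0 < lam i j)
    (α : Fin m → ℝ) (hα : ∀ i, α i = ∑ j : Fin n, lam i j)
    (β : Fin n → ℝ) (hβ : ∀ j, β j = ∑ i : Fin m, lam i j)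
    (ρ : ℝ) (hρ : ρ ≤ 2)
    (f : ℝ → ℝ)
    (hf : ∀ t, f t =
      ((∏ i : Fin m, Real.Gamma (1 + α i * t)) * ∏ j : Fin n, Real.Gamma (1 + β j * t)) /
        (∏ i : Fin m, ∏ j : Fin n, Real.Gamma (1 + lam i j * t)) ^ ρ) :
    ∀ (k : ℕ) (t : ℝ), 0 < t →
      0 ≤ (-1 : ℝ) ^ k *
        iteratedDeriv k (iteratedDeriv 2 (fun s => Real.log (f s))) t := by
  have : Nonempty (Fin m) := ⟨⟨0, hm⟩⟩
  have : Nonempty (Fin n) := ⟨⟨0, hn⟩⟩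
  have hα0 : ∀ i, 0 < α i := fun i => by
    rw [hα]
    exact Finset.sum_pos (fun j _ => hlam i j) Finset.univ_nonempty
  have hβ0 : ∀ j, 0 < β j := fun j => by
    rw [hβ]
    exact Finset.sum_pos (fun i _ => hlam i j) Finset.univ_nonempty
  have hΓ : ∀ a t : ℝ, 0 < a → 0 < t → 0 < Real.Gamma (1 + a * t) := fun a t ha ht =>
    Real.Gamma_pos_of_pos (by positivity)
  have hlog : ∀ t ∈ Ioi (0 : ℝ), Real.log (f t) =
      ((∑ i, Real.log (Real.Gamma (1 + α i * t))) + ∑ j, Real.log (Real.Gamma (1 + β j * t))) -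
        ρ * ∑ i, ∑ j, Real.log (Real.Gamma (1 + lam i j * t)) := by
    intro t ht
    have h1 : ∀ i ∈ Finset.univ, Real.Gamma (1 + α i * t) ≠ 0 :=
      fun i _ => (hΓ _ _ (hα0 i) ht).ne'
    have h2 : ∀ j ∈ Finset.univ, Real.Gamma (1 + β j * t) ≠ 0 :=
      fun j _ => (hΓ _ _ (hβ0 j) ht).ne'
    have h3 : ∀ i, ∀ j ∈ Finset.univ, Real.Gamma (1 + lam i j * t) ≠ 0 :=
      fun i j _ => (hΓ _ _ (hlam i j) ht).ne'
    have hP : 0 < ∏ i, ∏ j, Real.Gamma (1 + lam i j * t) :=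
      Finset.prod_pos fun i _ => Finset.prod_pos fun j _ => hΓ _ _ (hlam i j) ht
    rw [hf, Real.log_div (mul_ne_zero (Finset.prod_ne_zero_iff.2 h1)
        (Finset.prod_ne_zero_iff.2 h2)) (Real.rpow_pos_of_pos hP _).ne',
      Real.log_mul (Finset.prod_ne_zero_iff.2 h1) (Finset.prod_ne_zero_iff.2 h2),
      Real.log_rpow hP, Real.log_prod h1, Real.log_prod h2,
      Real.log_prod fun i _ => Finset.prod_ne_zero_iff.2 (h3 i)]
    simp only [fun i => Real.log_prod (h3 i)]
  set D : (ℝ → ℝ → ℝ) → ℝ → ℝ := fun g t =>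
    ((∑ i, g (α i) t) + ∑ j, g (β j) t) - ρ * ∑ i, ∑ j, g (lam i j) t with hD
  have hderiv : ∀ (g g' : ℝ → ℝ → ℝ), (∀ a t, 0 < a → 0 < t → HasDerivAt (g a) (g' a t) t) →
      ∀ t, 0 < t → HasDerivAt (D g) (D g' t) t := by
    intro g g' h t ht
    exact ((HasDerivAt.fun_sum fun i _ => h _ t (hα0 i) ht).add
      (HasDerivAt.fun_sum fun j _ => h _ t (hβ0 j) ht)).sub
      ((HasDerivAt.fun_sum fun i _ => HasDerivAt.fun_sum fun j _ => h _ t (hlam i j) ht).const_mul ρ)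
  have hfirst : ∀ t ∈ Ioi (0 : ℝ), deriv (fun s => Real.log (f s)) t =
      D (fun a => deriv fun s => Real.log (Real.Gamma (1 + a * s))) t := by
    intro t ht
    refine HasDerivAt.deriv ((hderiv (fun a s => Real.log (Real.Gamma (1 + a * s))) _ (fun a s ha hs =>
      (hasDerivAt_log_Gamma_one_add_mul ha hs).differentiableAt.hasDerivAt) t ht).congr_of_eventuallyEq
      ?_)
    filter_upwards [Ioi_mem_nhds ht] with s hs using hlog s hs
  have hsecond : ∀ t ∈ Ioi (0 : ℝ), iteratedDeriv 2 (fun s => Real.log (f s)) t =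
      D (gammaPoleSum 0) t := by
    intro t ht
    rw [iteratedDeriv_succ, iteratedDeriv_one]
    refine HasDerivAt.deriv ((hderiv _ _ (fun a s ha hs =>
      hasDerivAt_deriv_log_Gamma_one_add_mul ha hs) t ht).congr_of_eventuallyEq ?_)
    filter_upwards [Ioi_mem_nhds ht] with s hs using hfirst s hs
  have hiter : ∀ (k : ℕ), ∀ t ∈ Ioi (0 : ℝ),
      iteratedDeriv k (iteratedDeriv 2 (fun s => Real.log (f s))) t =
        (-1) ^ k * (k + 1).factorial * D (gammaPoleSum k) t := by
    intro k
    induction k with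
    | zero => simpa using hsecond
    | succ k ih =>
      intro t ht
      rw [iteratedDeriv_succ]
      refine HasDerivAt.deriv (((hderiv _ _ (fun a s ha hs =>
        hasDerivAt_gammaPoleSum k ha hs) t ht).const_mul
          ((-1) ^ k * ((k + 1).factorial : ℝ))).congr_of_eventuallyEq ?_ |>.congr_deriv ?_)
      · filter_upwards [Ioi_mem_nhds ht] with s hs using ih s hs
      · simp only [hD, ← Finset.mul_sum, Nat.factorial_succ (k + 1)]
        push_cast
        ring
  intro k t ht
  have hα' : ∑ i, ∑ j, gammaPoleSum k (lam i j) t ≤ ∑ i, gammaPoleSum k (α i) t :=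
    Finset.sum_le_sum fun i _ => hα i ▸ sum_gammaPoleSum_le k (hlam i) ht
  have hβ' : ∑ i, ∑ j, gammaPoleSum k (lam i j) t ≤ ∑ j, gammaPoleSum k (β j) t := by
    rw [Finset.sum_comm]
    exact Finset.sum_le_sum fun j _ => hβ j ▸ sum_gammaPoleSum_le k (fun i => hlam i j) ht
  have hS : 0 ≤ ∑ i, ∑ j, gammaPoleSum k (lam i j) t :=
    Finset.sum_nonneg fun i _ => Finset.sum_nonneg fun j _ =>
      (gammaPoleSum_pos k (hlam i j) ht.le).le
  have hDk : 0 ≤ D (gammaPoleSum k) t := by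
    have := mul_le_mul_of_nonneg_right hρ hS
    simp only [hD]
    linarith
  rw [hiter k t ht, ← mul_assoc, ← mul_assoc, ← mul_pow]
  simp only [mul_neg, mul_one, neg_neg, one_pow, one_mul]
  positivity
end

section
/- Let m, n be positive integers, λ_{ij} > 0 for 1 ≤ i ≤ m, 1 ≤ j ≤ n, α_i = ∑_{j=1}^n λ_{ij}, β_j = ∑_{i=1}^m λ_{ij}, and let ρ ≤ 2, with moreover ρ < 2 or max(m,n) ≥ 2. Then the image of (0, ∞) under the second derivative of t ↦ ln f(t), where f(t) = [∏_{i=1}^m Γ(1+α_i t) · ∏_{j=1}^n Γ(1+β_j t)] / [∏_{i=1}^m ∏_{j=1}^n Γ(1+λ_{ij} t)]^ρ, is exactly the open interval (0, (π²/6)·(∑_{i=1}^m α_i² + ∑_{j=1}^n β_j² − ρ ∑_{i=1}^m ∑_{j=1}^n λ_{ij}²)). -/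
open Finset

/-- `trigammaOneAdd x = ∑ k ≥ 1, 1 / (k + x) ^ 2`, the second derivative of `log Γ(1 + x)`. -/
noncomputable def trigammaOneAdd (x : ℝ) : ℝ := ∑' k : ℕ, 1 / ((k : ℝ) + 1 + x) ^ 2

/-- `digammaOneAdd x = ∑ k ≥ 1, (log ((k + 1) / k) - 1 / (k + x))`, the derivative of
`log Γ(1 + x)`. -/
noncomputable def digammaOneAdd (x : ℝ) : ℝ :=
  ∑' k : ℕ, (Real.log ((k : ℝ) + 2) - Real.log ((k : ℝ) + 1) - 1 / ((k : ℝ) + 1 + x))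

lemma hasSum_one_div_nat_add_one_sq :
    HasSum (fun k : ℕ => 1 / ((k : ℝ) + 1) ^ 2) (Real.pi ^ 2 / 6) := by
  have h := (hasSum_nat_add_iff' 1).2 hasSum_zeta_two
  simpa using h

lemma summable_one_div_nat_add_one_sq : Summable (fun k : ℕ => 1 / ((k : ℝ) + 1) ^ 2) :=
  hasSum_one_div_nat_add_one_sq.summable

lemma one_div_nat_add_one_add_sq_le {x : ℝ} (hx : 0 ≤ x) (k : ℕ) :
    1 / ((k : ℝ) + 1 + x) ^ 2 ≤ 1 / ((k : ℝ) + 1) ^ 2 := by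
  have h : (k : ℝ) + 1 ≤ (k : ℝ) + 1 + x := le_add_of_nonneg_right hx
  gcongr

lemma summable_trigammaOneAdd {x : ℝ} (hx : 0 ≤ x) :
    Summable (fun k : ℕ => 1 / ((k : ℝ) + 1 + x) ^ 2) :=
  summable_one_div_nat_add_one_sq.of_nonneg_of_le (fun k => by positivity)
    (one_div_nat_add_one_add_sq_le hx)

lemma trigammaOneAdd_zero : trigammaOneAdd 0 = Real.pi ^ 2 / 6 := by
  simpa [trigammaOneAdd] using hasSum_one_div_nat_add_one_sq.tsum_eq

lemma trigammaOneAdd_strictAntiOn : StrictAntiOn trigammaOneAdd (Set.Ici 0) := by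
  intro x hx y hy hxy
  have hx : 0 ≤ x := hx
  have hy : 0 ≤ y := hy
  refine Summable.tsum_lt_tsum (i := 0) (fun k => ?_) ?_ (summable_trigammaOneAdd hy)
    (summable_trigammaOneAdd hx)
  · gcongr
  · gcongr

lemma trigammaOneAdd_pos {x : ℝ} (hx : 0 ≤ x) : 0 < trigammaOneAdd x :=
  (summable_trigammaOneAdd hx).tsum_pos (fun k => by positivity) 0 (by positivity)

lemma continuousOn_trigammaOneAdd : ContinuousOn trigammaOneAdd (Set.Ici 0) := by
  refine continuousOn_tsum (u := fun k : ℕ => 1 / ((k : ℝ) + 1) ^ 2) (fun k => ?_)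
    summable_one_div_nat_add_one_sq (fun k x hx => ?_)
  · refine ContinuousOn.div (by fun_prop) (by fun_prop) fun x hx => ?_
    have : 0 ≤ x := hx
    positivity
  · have hx : 0 ≤ x := hx
    rw [Real.norm_of_nonneg (by positivity)]
    exact one_div_nat_add_one_add_sq_le hx k

lemma hasSum_telescoping_one {x : ℝ} (hx : 0 ≤ x) :
    HasSum (fun k : ℕ => x * (1 / ((k : ℝ) + 1 + x) ^ 2) +
      ((k : ℝ) + 1) / (((k : ℝ) + 1 + x) ^ 2 * ((k : ℝ) + 2 + x))) 1 := by
  rw [hasSum_iff_tendsto_nat_of_nonneg (fun k => by positivity)]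
  have hsum : ∀ N : ℕ, ∑ k ∈ range N, (x * (1 / ((k : ℝ) + 1 + x) ^ 2) +
      ((k : ℝ) + 1) / (((k : ℝ) + 1 + x) ^ 2 * ((k : ℝ) + 2 + x))) = N / (N + (1 + x)) := by
    intro N
    induction N with
    | zero => simp
    | succ N ih =>
      rw [sum_range_succ, ih]
      have h1 : (N : ℝ) + 1 + x ≠ 0 := by positivity
      have h2 : (N : ℝ) + 2 + x ≠ 0 := by positivity
      have h3 : (N : ℝ) + (1 + x) ≠ 0 := by positivity
      have h4 : (N : ℝ) + 1 + (1 + x) ≠ 0 := by positivity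
      push_cast
      field_simp
      ring
  simp_rw [hsum]
  exact tendsto_natCast_div_add_atTop (1 + x)

lemma summable_telescoping_remainder {x : ℝ} (hx : 0 ≤ x) :
    Summable (fun k : ℕ => ((k : ℝ) + 1) / (((k : ℝ) + 1 + x) ^ 2 * ((k : ℝ) + 2 + x))) :=
  (hasSum_telescoping_one hx).summable.of_nonneg_of_le (fun k => by positivity)
    fun k => le_add_of_nonneg_left (by positivity)

lemma mul_trigammaOneAdd {x : ℝ} (hx : 0 ≤ x) : x * trigammaOneAdd x =
    1 - ∑' k : ℕ, ((k : ℝ) + 1) / (((k : ℝ) + 1 + x) ^ 2 * ((k : ℝ) + 2 + x)) := by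
  rw [eq_sub_iff_add_eq, trigammaOneAdd, ← tsum_mul_left,
    ← ((summable_trigammaOneAdd hx).mul_left x).tsum_add (summable_telescoping_remainder hx)]
  exact (hasSum_telescoping_one hx).tsum_eq

lemma mul_trigammaOneAdd_strictMonoOn :
    StrictMonoOn (fun x => x * trigammaOneAdd x) (Set.Ici 0) := by
  intro x hx y hy hxy
  have hx : 0 ≤ x := hx
  have hy : 0 ≤ y := hy
  simp only [mul_trigammaOneAdd hx, mul_trigammaOneAdd hy]
  refine sub_lt_sub_left (Summable.tsum_lt_tsum (i := 0) (fun k => ?_) ?_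
    (summable_telescoping_remainder hy) (summable_telescoping_remainder hx)) _
  · gcongr
  · gcongr

lemma mul_trigammaOneAdd_le_one {x : ℝ} (hx : 0 ≤ x) : x * trigammaOneAdd x ≤ 1 := by
  rw [mul_trigammaOneAdd hx]
  exact sub_le_self _ (tsum_nonneg fun k => by positivity)

open Filter Topology in
lemma tendsto_trigammaOneAdd_atTop : Tendsto trigammaOneAdd atTop (𝓝 0) := by
  refine squeeze_zero' ?_ ?_ tendsto_inv_atTop_zero
  · filter_upwards [eventually_ge_atTop 0] with x hx using (trigammaOneAdd_pos hx).le
  · filter_upwards [eventually_gt_atTop 0] with x hx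
    rw [← one_div, le_div_iff₀ hx, mul_comm]
    exact mul_trigammaOneAdd_le_one hx.le

lemma abs_digammaOneAdd_term_le {x R : ℝ} (hx : 0 < x) (hxR : x ≤ R) (k : ℕ) :
    |Real.log ((k : ℝ) + 2) - Real.log ((k : ℝ) + 1) - 1 / ((k : ℝ) + 1 + x)| ≤
      (1 + R) * (1 / ((k : ℝ) + 1) ^ 2) := by
  have hk : (0 : ℝ) < (k : ℝ) + 1 := by positivity
  have hup : Real.log ((k : ℝ) + 2) - Real.log ((k : ℝ) + 1) ≤ 1 / ((k : ℝ) + 1) := by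
    rw [← Real.log_div (by positivity) hk.ne']
    refine (Real.log_le_sub_one_of_pos (by positivity)).trans (le_of_eq ?_)
    field_simp
    ring
  have hlow : 1 / ((k : ℝ) + 2) ≤ Real.log ((k : ℝ) + 2) - Real.log ((k : ℝ) + 1) := by
    rw [← Real.log_div (by positivity) hk.ne']
    refine (le_of_eq ?_).trans (Real.one_sub_inv_le_log_of_pos (by positivity))
    field_simp
    ring
  have hinv : ∀ y : ℝ, 0 ≤ y →
      1 / ((k : ℝ) + 1) - y * (1 / ((k : ℝ) + 1) ^ 2) ≤ 1 / ((k : ℝ) + 1 + y) := by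
    intro y hy
    rw [← sub_nonneg]
    have : 1 / ((k : ℝ) + 1 + y) - (1 / ((k : ℝ) + 1) - y * (1 / ((k : ℝ) + 1) ^ 2)) =
        y ^ 2 / (((k : ℝ) + 1) ^ 2 * ((k : ℝ) + 1 + y)) := by
      field_simp
      ring
    rw [this]
    positivity
  have h1 := hinv 1 zero_le_one
  rw [add_assoc (k : ℝ) 1 1, one_add_one_eq_two] at h1
  have h2 := hinv x hx.le
  have h3 : 1 / ((k : ℝ) + 1 + x) ≤ 1 / ((k : ℝ) + 1) :=
    one_div_le_one_div_of_le hk (le_add_of_nonneg_right hx.le)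
  have h4 : x * (1 / ((k : ℝ) + 1) ^ 2) ≤ R * (1 / ((k : ℝ) + 1) ^ 2) := by gcongr
  have h5 : 0 ≤ 1 / ((k : ℝ) + 1) ^ 2 := by positivity
  have h6 : 0 ≤ R * (1 / ((k : ℝ) + 1) ^ 2) := mul_nonneg (hx.le.trans hxR) h5
  rw [abs_le]
  constructor <;> linarith

lemma hasDerivAt_digammaOneAdd {x : ℝ} (hx : 0 < x) :
    HasDerivAt digammaOneAdd (trigammaOneAdd x) x := by
  refine hasDerivAt_tsum_of_isPreconnected (t := Set.Ioi (0 : ℝ)) (y₀ := 1)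
    (g := fun (k : ℕ) x =>
      Real.log ((k : ℝ) + 2) - Real.log ((k : ℝ) + 1) - 1 / ((k : ℝ) + 1 + x))
    (g' := fun (k : ℕ) x => 1 / ((k : ℝ) + 1 + x) ^ 2)
    summable_one_div_nat_add_one_sq isOpen_Ioi isPreconnected_Ioi
    (fun k y hy => ?_) (fun k y hy => ?_) (Set.mem_Ioi.2 zero_lt_one) ?_ hx
  · have hy : 0 < y := hy
    have h := ((((hasDerivAt_id y).const_add ((k : ℝ) + 1)).inv
      (by simp only [id]; positivity)).const_sub
        (Real.log ((k : ℝ) + 2) - Real.log ((k : ℝ) + 1)))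
    convert h using 1
    · ext z
      simp
    · simp [neg_div]
  · have hy : 0 < y := hy
    rw [Real.norm_of_nonneg (by positivity)]
    exact one_div_nat_add_one_add_sq_le hy.le k
  · exact (summable_one_div_nat_add_one_sq.mul_left (1 + 1)).of_norm_bounded
      fun k => abs_digammaOneAdd_term_le zero_lt_one le_rfl k

open Filter Topology in
lemma tendsto_sum_log_Gamma_one_add {x : ℝ} (hx : 0 < x) :
    Tendsto (fun N : ℕ => ∑ k ∈ range N, (x * (Real.log ((k : ℝ) + 2) - Real.log ((k : ℝ) + 1)) -
      (Real.log ((k : ℝ) + 1 + x) - Real.log ((k : ℝ) + 1)))) atTop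
      (𝓝 (Real.log (Real.Gamma (1 + x)))) := by
  have hsum : ∀ N : ℕ, ∑ k ∈ range N,
      (x * (Real.log ((k : ℝ) + 2) - Real.log ((k : ℝ) + 1)) -
        (Real.log ((k : ℝ) + 1 + x) - Real.log ((k : ℝ) + 1))) =
      Real.BohrMollerup.logGammaSeq x N + Real.log x +
        x * (Real.log ((N : ℝ) + 1) - Real.log N) := by
    intro N
    induction N with
    | zero => simp [Real.BohrMollerup.logGammaSeq]
    | succ N ih =>
      rw [sum_range_succ, ih]
      simp only [Real.BohrMollerup.logGammaSeq]
      rw [sum_range_succ _ (N + 1), Nat.factorial_succ]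
      push_cast
      rw [Real.log_mul (by positivity) (by positivity), add_assoc (N : ℝ) 1 1,
        one_add_one_eq_two, add_comm x ((N : ℝ) + 1)]
      ring
  simp_rw [hsum]
  have h := ((Real.BohrMollerup.tendsto_log_gamma hx).add_const (Real.log x)).add
    (Real.tendsto_log_nat_add_one_sub_log.const_mul x)
  rwa [mul_zero, add_zero, add_comm (Real.log (Real.Gamma x)),
    ← Real.log_mul hx.ne' (Real.Gamma_pos_of_pos hx).ne', ← Real.Gamma_add_one hx.ne',
    add_comm x 1] at h

lemma hasDerivAt_log_Gamma_one_add {x : ℝ} (hx : 0 < x) :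
    HasDerivAt (fun y => Real.log (Real.Gamma (1 + y))) (digammaOneAdd x) x := by
  have hu := summable_one_div_nat_add_one_sq.mul_left (1 + (x + 2))
  have hderiv : ∀ (k : ℕ) (y : ℝ), y ∈ Set.Ioo 0 (x + 2) → HasDerivAt
      (fun y => y * (Real.log ((k : ℝ) + 2) - Real.log ((k : ℝ) + 1)) -
        (Real.log ((k : ℝ) + 1 + y) - Real.log ((k : ℝ) + 1)))
      (Real.log ((k : ℝ) + 2) - Real.log ((k : ℝ) + 1) - 1 / ((k : ℝ) + 1 + y)) y := by
    intro k y hy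
    have hy := hy.1
    have h1 := (hasDerivAt_id y).mul_const (Real.log ((k : ℝ) + 2) - Real.log ((k : ℝ) + 1))
    have h2 := (((hasDerivAt_id y).const_add ((k : ℝ) + 1)).log
      (by simp only [id]; positivity)).sub_const (Real.log ((k : ℝ) + 1))
    convert! h1.sub h2 using 1
    simp
  have hbound : ∀ (k : ℕ) (y : ℝ), y ∈ Set.Ioo 0 (x + 2) →
      ‖Real.log ((k : ℝ) + 2) - Real.log ((k : ℝ) + 1) - 1 / ((k : ℝ) + 1 + y)‖ ≤
        (1 + (x + 2)) * (1 / ((k : ℝ) + 1) ^ 2) :=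
    fun k y hy => abs_digammaOneAdd_term_le hy.1 hy.2.le k
  have hone : (1 : ℝ) ∈ Set.Ioo 0 (x + 2) := ⟨zero_lt_one, by linarith⟩
  have hxm : x ∈ Set.Ioo 0 (x + 2) := ⟨hx, by linarith⟩
  have hzero : Summable fun k : ℕ => 1 * (Real.log ((k : ℝ) + 2) - Real.log ((k : ℝ) + 1)) -
      (Real.log ((k : ℝ) + 1 + 1) - Real.log ((k : ℝ) + 1)) := by
    simp only [add_assoc, one_add_one_eq_two, one_mul, sub_self]
    exact summable_zero
  refine (hasDerivAt_tsum_of_isPreconnected hu isOpen_Ioo isPreconnected_Ioo hderiv hbound hone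
    hzero hxm).congr_of_eventuallyEq ?_
  filter_upwards [isOpen_Ioo.mem_nhds hxm] with y hy
  exact tendsto_nhds_unique (tendsto_sum_log_Gamma_one_add hy.1)
    (summable_of_summable_hasDerivAt_of_isPreconnected hu isOpen_Ioo isPreconnected_Ioo hderiv
      hbound hone hzero hy).hasSum.tendsto_sum_nat

lemma sum_mul_le_of_strictMonoOn {ι : Type*} [Fintype ι] {h : ℝ → ℝ}
    (hmono : StrictMonoOn h (Set.Ioi 0)) {x : ι → ℝ} (hx : ∀ i, 0 < x i) :
    ∑ i, x i * h (x i) ≤ (∑ i, x i) * h (∑ i, x i) := by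
  rw [sum_mul]
  refine sum_le_sum fun i _ => ?_
  have hle : x i ≤ ∑ i, x i := single_le_sum (fun j _ => (hx j).le) (mem_univ i)
  exact mul_le_mul_of_nonneg_left
    (hmono.monotoneOn (hx i) ((hx i).trans_le hle) hle) (hx i).le

lemma sum_mul_lt_of_strictMonoOn {ι : Type*} [Fintype ι] [Nontrivial ι] {h : ℝ → ℝ}
    (hmono : StrictMonoOn h (Set.Ioi 0)) {x : ι → ℝ} (hx : ∀ i, 0 < x i) :
    ∑ i, x i * h (x i) < (∑ i, x i) * h (∑ i, x i) := by
  rw [sum_mul]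
  have : Nonempty ι := inferInstance
  refine sum_lt_sum_of_nonempty univ_nonempty fun i _ => ?_
  obtain ⟨j, hj⟩ := exists_ne i
  have hlt : x i < ∑ i, x i :=
    single_lt_sum hj (mem_univ i) (mem_univ j) (hx j) fun k _ _ => (hx k).le
  exact mul_lt_mul_of_pos_left (hmono (hx i) ((hx i).trans hlt) hlt) (hx i)

/-- The weighted gap between row sums, column sums and entries of a positive matrix is positive
for a function `x ↦ x * h x` with `h` positive and strictly increasing. -/
lemma row_col_sum_sub_pos {m n : ℕ} (hm : 0 < m) (hn : 0 < n) {lam : Fin m → Fin n → ℝ}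
    (hlam : ∀ i j, 0 < lam i j) {ρ : ℝ} (hρ : ρ ≤ 2) (hρ' : ρ < 2 ∨ 2 ≤ max m n)
    {h : ℝ → ℝ} (hpos : ∀ x, 0 < x → 0 < h x) (hmono : StrictMonoOn h (Set.Ioi 0)) :
    0 < (∑ i, (∑ j, lam i j) * h (∑ j, lam i j)) + (∑ j, (∑ i, lam i j) * h (∑ i, lam i j)) -
      ρ * ∑ i, ∑ j, lam i j * h (lam i j) := by
  have : Nonempty (Fin m) := ⟨⟨0, hm⟩⟩
  have : Nonempty (Fin n) := ⟨⟨0, hn⟩⟩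
  have hS : 0 < ∑ i, ∑ j, lam i j * h (lam i j) :=
    sum_pos (fun i _ => sum_pos (fun j _ => mul_pos (hlam i j) (hpos _ (hlam i j)))
      univ_nonempty) univ_nonempty
  have hrow : ∑ i, ∑ j, lam i j * h (lam i j) ≤ ∑ i, (∑ j, lam i j) * h (∑ j, lam i j) :=
    sum_le_sum fun i _ => sum_mul_le_of_strictMonoOn hmono (hlam i)
  have hcol : ∑ i, ∑ j, lam i j * h (lam i j) ≤ ∑ j, (∑ i, lam i j) * h (∑ i, lam i j) := by
    rw [sum_comm]
    exact sum_le_sum fun j _ => sum_mul_le_of_strictMonoOn hmono fun i => hlam i j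
  rcases hρ' with hlt | hmax
  · nlinarith
  · have hle : ρ * ∑ i, ∑ j, lam i j * h (lam i j) ≤ 2 * ∑ i, ∑ j, lam i j * h (lam i j) := by
      gcongr
    rcases le_max_iff.1 hmax with hm2 | hn2
    · have : Nontrivial (Fin m) := Fin.nontrivial_iff_two_le.2 hm2
      have : ∑ i, ∑ j, lam i j * h (lam i j) < ∑ j, (∑ i, lam i j) * h (∑ i, lam i j) := by
        rw [sum_comm]
        exact sum_lt_sum_of_nonempty univ_nonempty fun j _ =>
          sum_mul_lt_of_strictMonoOn hmono fun i => hlam i j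
      linarith
    · have : Nontrivial (Fin n) := Fin.nontrivial_iff_two_le.2 hn2
      have : ∑ i, ∑ j, lam i j * h (lam i j) < ∑ i, (∑ j, lam i j) * h (∑ j, lam i j) :=
        sum_lt_sum_of_nonempty univ_nonempty fun i _ => sum_mul_lt_of_strictMonoOn hmono (hlam i)
      linarith

lemma hasDerivAt_log_Gamma_one_add_mul_s6 {a t : ℝ} (ha : 0 < a) (ht : 0 < t) :
    HasDerivAt (fun s => Real.log (Real.Gamma (1 + a * s))) (a * digammaOneAdd (a * t)) t := by
  have h := (hasDerivAt_log_Gamma_one_add (mul_pos ha ht)).comp t ((hasDerivAt_id t).const_mul a)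
  simpa [mul_comm, Function.comp_def] using h

lemma hasDerivAt_mul_digammaOneAdd_mul {a t : ℝ} (ha : 0 < a) (ht : 0 < t) :
    HasDerivAt (fun s => a * digammaOneAdd (a * s)) (a ^ 2 * trigammaOneAdd (a * t)) t := by
  have h := ((hasDerivAt_digammaOneAdd (mul_pos ha ht)).comp t
    ((hasDerivAt_id t).const_mul a)).const_mul a
  convert! h using 1
  simp
  ring

lemma iteratedDeriv_two_log_ratio_Gamma {ι κ : Type*} [Fintype ι] [Fintype κ]
    {lam : ι → κ → ℝ} (hlam : ∀ i j, 0 < lam i j) {α : ι → ℝ} (hα : ∀ i, 0 < α i)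
    {β : κ → ℝ} (hβ : ∀ j, 0 < β j) (ρ : ℝ) {t : ℝ} (ht : 0 < t) :
    iteratedDeriv 2 (fun t => Real.log
      (((∏ i, Real.Gamma (1 + α i * t)) * ∏ j, Real.Gamma (1 + β j * t)) /
        (∏ i, ∏ j, Real.Gamma (1 + lam i j * t)) ^ ρ)) t =
      (∑ i, α i ^ 2 * trigammaOneAdd (α i * t)) + (∑ j, β j ^ 2 * trigammaOneAdd (β j * t)) -
        ρ * ∑ i, ∑ j, lam i j ^ 2 * trigammaOneAdd (lam i j * t) := by
  have hΓ : ∀ a s : ℝ, 0 < a → 0 < s → 0 < Real.Gamma (1 + a * s) :=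
    fun a s ha hs => Real.Gamma_pos_of_pos (by positivity)
  have hlog : ∀ s : ℝ, 0 < s → Real.log
      (((∏ i, Real.Gamma (1 + α i * s)) * ∏ j, Real.Gamma (1 + β j * s)) /
        (∏ i, ∏ j, Real.Gamma (1 + lam i j * s)) ^ ρ) =
      (∑ i, Real.log (Real.Gamma (1 + α i * s))) + (∑ j, Real.log (Real.Gamma (1 + β j * s))) -
        ρ * ∑ i, ∑ j, Real.log (Real.Gamma (1 + lam i j * s)) := by
    intro s hs
    have h1 : 0 < ∏ i, Real.Gamma (1 + α i * s) := prod_pos fun i _ => hΓ _ _ (hα i) hs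
    have h2 : 0 < ∏ j, Real.Gamma (1 + β j * s) := prod_pos fun j _ => hΓ _ _ (hβ j) hs
    have h3 : ∀ i, 0 < ∏ j, Real.Gamma (1 + lam i j * s) :=
      fun i => prod_pos fun j _ => hΓ _ _ (hlam i j) hs
    have h4 : 0 < ∏ i, ∏ j, Real.Gamma (1 + lam i j * s) := prod_pos fun i _ => h3 i
    rw [Real.log_div (mul_pos h1 h2).ne' (Real.rpow_pos_of_pos h4 ρ).ne',
      Real.log_mul h1.ne' h2.ne', Real.log_rpow h4,
      Real.log_prod fun i _ => (hΓ _ _ (hα i) hs).ne',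
      Real.log_prod fun j _ => (hΓ _ _ (hβ j) hs).ne', Real.log_prod fun i _ => (h3 i).ne']
    congr 2
    exact sum_congr rfl fun i _ => Real.log_prod fun j _ => (hΓ _ _ (hlam i j) hs).ne'
  have hderiv : ∀ s : ℝ, 0 < s → deriv (fun t => Real.log
      (((∏ i, Real.Gamma (1 + α i * t)) * ∏ j, Real.Gamma (1 + β j * t)) /
        (∏ i, ∏ j, Real.Gamma (1 + lam i j * t)) ^ ρ)) s =
      (∑ i, α i * digammaOneAdd (α i * s)) + (∑ j, β j * digammaOneAdd (β j * s)) -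
        ρ * ∑ i, ∑ j, lam i j * digammaOneAdd (lam i j * s) := by
    intro s hs
    refine HasDerivAt.deriv (HasDerivAt.congr_of_eventuallyEq ?_ (Filter.eventually_of_mem
      (Ioi_mem_nhds hs) hlog))
    exact ((HasDerivAt.fun_sum fun i _ => hasDerivAt_log_Gamma_one_add_mul_s6 (hα i) hs).add
      (HasDerivAt.fun_sum fun j _ => hasDerivAt_log_Gamma_one_add_mul_s6 (hβ j) hs)).sub
      ((HasDerivAt.fun_sum fun i _ => HasDerivAt.fun_sum fun j _ =>
        hasDerivAt_log_Gamma_one_add_mul_s6 (hlam i j) hs).const_mul ρ)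
  rw [iteratedDeriv_succ, iteratedDeriv_one]
  refine HasDerivAt.deriv (HasDerivAt.congr_of_eventuallyEq ?_ (Filter.eventually_of_mem
    (Ioi_mem_nhds ht) hderiv))
  exact ((HasDerivAt.fun_sum fun i _ => hasDerivAt_mul_digammaOneAdd_mul (hα i) ht).add
    (HasDerivAt.fun_sum fun j _ => hasDerivAt_mul_digammaOneAdd_mul (hβ j) ht)).sub
    ((HasDerivAt.fun_sum fun i _ => HasDerivAt.fun_sum fun j _ =>
      hasDerivAt_mul_digammaOneAdd_mul (hlam i j) ht).const_mul ρ)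

theorem image_second_deriv_log_ratio_gamma
    (m n : ℕ) (hm : 0 < m) (hn : 0 < n)
    (lam : Fin m → Fin n → ℝ) (hlam : ∀ i j, 0 < lam i j)
    (α : Fin m → ℝ) (hα : ∀ i, α i = ∑ j : Fin n, lam i j)
    (β : Fin n → ℝ) (hβ : ∀ j, β j = ∑ i : Fin m, lam i j)
    (ρ : ℝ) (hρ : ρ ≤ 2) (hρ' : ρ < 2 ∨ 2 ≤ max m n)
    (f : ℝ → ℝ)
    (hf : ∀ t, f t =
      ((∏ i : Fin m, Real.Gamma (1 + α i * t)) * ∏ j : Fin n, Real.Gamma (1 + β j * t)) /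
        (∏ i : Fin m, ∏ j : Fin n, Real.Gamma (1 + lam i j * t)) ^ ρ) :
    iteratedDeriv 2 (fun s => Real.log (f s)) '' Set.Ioi 0 =
      Set.Ioo 0 (Real.pi ^ 2 / 6 *
        ((∑ i : Fin m, (α i) ^ 2) + (∑ j : Fin n, (β j) ^ 2) -
          ρ * ∑ i : Fin m, ∑ j : Fin n, (lam i j) ^ 2)) := by
  have : Nonempty (Fin m) := ⟨⟨0, hm⟩⟩
  have : Nonempty (Fin n) := ⟨⟨0, hn⟩⟩
  have hαpos : ∀ i, 0 < α i := fun i => hα i ▸ sum_pos (fun j _ => hlam i j) univ_nonempty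
  have hβpos : ∀ j, 0 < β j := fun j => hβ j ▸ sum_pos (fun i _ => hlam i j) univ_nonempty
  obtain rfl : f = _ := funext hf
  refine (Set.image_congr fun t (ht : t ∈ Set.Ioi 0) =>
    iteratedDeriv_two_log_ratio_Gamma hlam hαpos hβpos ρ ht).trans ?_
  have hcont : ContinuousOn (fun t => (∑ i, α i ^ 2 * trigammaOneAdd (α i * t)) +
      (∑ j, β j ^ 2 * trigammaOneAdd (β j * t)) -
        ρ * ∑ i, ∑ j, lam i j ^ 2 * trigammaOneAdd (lam i j * t)) (Set.Ici 0) := by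
    have hscale : ∀ a : ℝ, 0 < a →
        ContinuousOn (fun t => a ^ 2 * trigammaOneAdd (a * t)) (Set.Ici 0) := fun a ha =>
      continuousOn_const.mul (continuousOn_trigammaOneAdd.comp (by fun_prop)
        fun t ht => mul_nonneg ha.le ht)
    exact ((continuousOn_finsetSum _ fun i _ => hscale _ (hαpos i)).add
      (continuousOn_finsetSum _ fun j _ => hscale _ (hβpos j))).sub
      (continuousOn_const.mul (continuousOn_finsetSum _ fun i _ =>
        continuousOn_finsetSum _ fun j _ => hscale _ (hlam i j)))
  apply Set.Subset.antisymm
  · rintro _ ⟨t, ht, rfl⟩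
    have ht : 0 < t := ht
    constructor
    · have hpos : ∀ x, 0 < x → 0 < x * trigammaOneAdd (x * t) := fun x hx =>
        mul_pos hx (trigammaOneAdd_pos (by positivity))
      have hmono : StrictMonoOn (fun x => x * trigammaOneAdd (x * t)) (Set.Ioi 0) := by
        intro x hx y hy hxy
        have h := mul_trigammaOneAdd_strictMonoOn (Set.mem_Ici.2 (mul_pos hx ht).le)
          (Set.mem_Ici.2 (mul_pos hy ht).le) (mul_lt_mul_of_pos_right hxy ht)
        simp only [mul_right_comm _ t] at h
        exact lt_of_mul_lt_mul_right h ht.le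
      have h := row_col_sum_sub_pos hm hn hlam hρ hρ' hpos hmono
      simpa only [← hα, ← hβ, ← mul_assoc, ← sq] using h
    · have hpos : ∀ x, 0 < x → 0 < x * (Real.pi ^ 2 / 6 - trigammaOneAdd (x * t)) :=
        fun x hx => mul_pos hx (sub_pos.2 (trigammaOneAdd_zero ▸ trigammaOneAdd_strictAntiOn
          Set.self_mem_Ici (Set.mem_Ici.2 (mul_pos hx ht).le) (mul_pos hx ht)))
      have hmono : StrictMonoOn (fun x => x * (Real.pi ^ 2 / 6 - trigammaOneAdd (x * t)))
          (Set.Ioi 0) := by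
        intro x hx y hy hxy
        have hx : 0 < x := hx
        have hanti := trigammaOneAdd_strictAntiOn (Set.mem_Ici.2 (mul_pos hx ht).le)
          (Set.mem_Ici.2 (mul_pos hy ht).le) (mul_lt_mul_of_pos_right hxy ht)
        exact mul_lt_mul hxy (sub_le_sub_left hanti.le _) (pos_of_mul_pos_right (hpos x hx) hx.le)
          (hx.trans hxy).le
      have h := row_col_sum_sub_pos hm hn hlam hρ hρ' hpos hmono
      simp only [← hα, ← hβ, ← mul_assoc, ← sq, mul_sub, sum_sub_distrib, ← sum_mul] at h
      simp only
      linarith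
  · have hzero : Filter.Tendsto (fun t => (∑ i, α i ^ 2 * trigammaOneAdd (α i * t)) +
        (∑ j, β j ^ 2 * trigammaOneAdd (β j * t)) -
          ρ * ∑ i, ∑ j, lam i j ^ 2 * trigammaOneAdd (lam i j * t)) (nhdsWithin 0 (Set.Ioi 0))
        (nhds (Real.pi ^ 2 / 6 * ((∑ i, α i ^ 2) + (∑ j, β j ^ 2) -
          ρ * ∑ i, ∑ j, lam i j ^ 2))) := by
      have h := ((hcont 0 Set.self_mem_Ici).mono Set.Ioi_subset_Ici_self).tendsto
      simp only [mul_zero, trigammaOneAdd_zero, ← sum_mul] at h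
      convert h using 2
      ring
    have htop : Filter.Tendsto (fun t => (∑ i, α i ^ 2 * trigammaOneAdd (α i * t)) +
        (∑ j, β j ^ 2 * trigammaOneAdd (β j * t)) -
          ρ * ∑ i, ∑ j, lam i j ^ 2 * trigammaOneAdd (lam i j * t)) Filter.atTop (nhds 0) := by
      have hscale : ∀ a : ℝ, 0 < a → Filter.Tendsto (fun t => a ^ 2 * trigammaOneAdd (a * t))
          Filter.atTop (nhds 0) := fun a ha => by
        simpa using (tendsto_trigammaOneAdd_atTop.comp
          (Filter.tendsto_id.const_mul_atTop ha)).const_mul (a ^ 2)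
      simpa using ((tendsto_finsetSum _ fun i _ => hscale _ (hαpos i)).add
        (tendsto_finsetSum _ fun j _ => hscale _ (hβpos j))).sub
        ((tendsto_finsetSum _ fun i _ =>
          tendsto_finsetSum _ fun j _ => hscale _ (hlam i j)).const_mul ρ)
    exact isPreconnected_Ioi.intermediate_value_Ioo
      (Filter.le_principal_iff.2 (Filter.Ioi_mem_atTop 0))
      (Filter.le_principal_iff.2 self_mem_nhdsWithin)
      (hcont.mono Set.Ioi_subset_Ici_self) htop hzero
end

section
/- Let m, n be positive integers, λ_{ij} > 0 for 1 ≤ i ≤ m, 1 ≤ j ≤ n, α_i = ∑_{j=1}^n λ_{ij}, β_j = ∑_{i=1}^m λ_{ij}, and let ρ < 2. Then f(t) = [∏_{i=1}^m Γ(1+α_i t) · ∏_{j=1}^n Γ(1+β_j t)] / [∏_{i=1}^m ∏_{j=1}^n Γ(1+λ_{ij} t)]^ρ satisfies f(t) → 1 as t → 0⁺ and f(t) → ∞ as t → ∞, and f attains a unique minimum on (0, ∞): there exists a unique t₀ ∈ (0,∞) with f(t₀) ≤ f(t) for all t > 0, and f is strictly decreasing on (0, t₀] and strictly increasing on [t₀,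 ∞). -/
open Finset Filter

lemma one_div_sq_sub_ge {A x : ℝ} (hA : 1 ≤ A) (hx : 0 ≤ x) :
    (1 / (A - 1 / 4) - 1 / (A + 3 / 4)) - x * (1 / (A - 1 / 2) ^ 2 - 1 / (A + 1 / 2) ^ 2) ≤
      1 / A ^ 2 - 2 * x / A ^ 3 := by
  have h1 : 1 / (A - 1 / 4) - 1 / (A + 3 / 4) ≤ 1 / A ^ 2 := by
    rw [div_sub_div _ _ (by linarith) (by linarith), div_le_div_iff₀ (by nlinarith) (by positivity)]
    nlinarith
  have h2 : 2 / A ^ 3 ≤ 1 / (A - 1 / 2) ^ 2 - 1 / (A + 1 / 2) ^ 2 := by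
    have h3 : 0 < A - 1 / 2 := by linarith
    rw [div_sub_div _ _ (by positivity) (by positivity),
      div_le_div_iff₀ (by positivity) (by positivity)]
    have : 0 ≤ A ^ 2 := sq_nonneg A
    nlinarith
  have h4 := mul_le_mul_of_nonneg_left h2 hx
  have h5 : 2 * x / A ^ 3 = x * (2 / A ^ 3) := by ring
  linarith

lemma sum_one_div_sq_sub_ge {x : ℝ} (hx : 0 ≤ x) (N : ℕ) :
    x / (N + 1 / 2 + x) ^ 2 - 1 / (N + 3 / 4 + x) ≤
      ∑ k ∈ range N, (1 / (1 + x + k) ^ 2 - 2 * x / (1 + x + k) ^ 3) := by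
  induction N with
  | zero =>
    simp only [Nat.cast_zero, range_zero, sum_empty, zero_add]
    rw [sub_nonpos, div_le_div_iff₀ (by positivity) (by positivity)]
    nlinarith
  | succ N ih =>
    rw [sum_range_succ]
    have hN : (0 : ℝ) ≤ N := N.cast_nonneg
    have h := one_div_sq_sub_ge (A := 1 + x + N) (by linarith) hx
    have e1 : 1 + x + N - 1 / 4 = N + 3 / 4 + x := by ring
    have e2 : 1 + x + N + 3 / 4 = (N + 1 : ℝ) + 3 / 4 + x := by ring
    have e3 : 1 + x + N - 1 / 2 = N + 1 / 2 + x := by ring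
    have e4 : 1 + x + N + 1 / 2 = (N + 1 : ℝ) + 1 / 2 + x := by ring
    rw [e1, e2, e3, e4] at h
    push_cast
    have e5 : ∀ y : ℝ, x / y = x * (1 / y) := fun y => by ring
    rw [e5] at ih ⊢
    linarith

lemma monotoneOn_mul_sum_one_div_sq (n : ℕ) :
    MonotoneOn (fun x : ℝ => x * ((∑ k ∈ range (n + 1), 1 / (1 + x + k) ^ 2) + 1 / (n + 1)))
      (Set.Ici 0) := by
  have hd : ∀ x : ℝ, 0 ≤ x → HasDerivAt
      (fun x : ℝ => x * ((∑ k ∈ range (n + 1), 1 / (1 + x + k) ^ 2) + 1 / (n + 1)))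
      ((∑ k ∈ range (n + 1), (1 / (1 + x + k) ^ 2 - 2 * x / (1 + x + k) ^ 3)) + 1 / (n + 1))
      x := by
    intro x hx
    have h1 : ∀ k ∈ range (n + 1),
        HasDerivAt (fun x : ℝ => 1 / (1 + x + k) ^ 2) (-2 / (1 + x + k) ^ 3) x := by
      intro k _
      have hk : (1 + x + k) ≠ 0 := by positivity
      have := ((((hasDerivAt_id x).const_add 1).add_const (k : ℝ)).pow 2).inv (pow_ne_zero 2 hk)
      simp only [id] at this
      refine (this.congr_deriv ?_).congr_of_eventuallyEq (Eventually.of_forall fun y => ?_)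
      · simp; field_simp
      · simp
    refine ((hasDerivAt_id x).mul
      ((HasDerivAt.fun_sum h1).add_const (1 / ((n : ℝ) + 1)))).congr_deriv ?_
    simp only [id, one_mul, sum_sub_distrib, mul_sum]
    rw [add_right_comm, sub_eq_add_neg, ← sum_neg_distrib]
    congr 2
    exact sum_congr rfl fun k _ => by ring
  refine monotoneOn_of_hasDerivWithinAt_nonneg (convex_Ici 0)
    (fun x hx => (hd x hx).continuousAt.continuousWithinAt)
    (fun x hx => (hd x (interior_subset hx)).hasDerivWithinAt) fun x hx => ?_
  have hx : 0 ≤ x := interior_subset hx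
  have h := sum_one_div_sq_sub_ge hx (n + 1)
  have h1 : 1 / (((n + 1 : ℕ) : ℝ) + 3 / 4 + x) ≤ 1 / (n + 1) :=
    one_div_le_one_div_of_le (by positivity) (by push_cast; linarith)
  have h2 : 0 ≤ x / (((n + 1 : ℕ) : ℝ) + 1 / 2 + x) ^ 2 := by positivity
  linarith

lemma convexOn_comp_add_mul_sub {F F' F'' : ℝ → ℝ}
    (hF : ∀ x, 0 ≤ x → HasDerivAt F (F' x) x) (hF' : ∀ x, 0 ≤ x → HasDerivAt F' (F'' x) x)
    (hmono : MonotoneOn (fun x => x * F'' x) (Set.Ici 0)) {a b : ℝ} (ha : 0 ≤ a) (hb : 0 ≤ b) :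
    ConvexOn ℝ (Set.Ici 0) fun t => F ((a + b) * t) - F (a * t) - F (b * t) := by
  have hcomp : ∀ {G G' : ℝ → ℝ}, (∀ x, 0 ≤ x → HasDerivAt G (G' x) x) → ∀ {c t : ℝ}, 0 ≤ c →
      0 ≤ t → HasDerivAt (fun t => G (c * t)) (c * G' (c * t)) t := by
    intro G G' hG c t hc ht
    have := (hG (c * t) (by positivity)).comp t ((hasDerivAt_id t).const_mul c)
    exact this.congr_deriv (by ring)
  have hd : ∀ t, 0 ≤ t → HasDerivAt (fun t => F ((a + b) * t) - F (a * t) - F (b * t))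
      ((a + b) * F' ((a + b) * t) - a * F' (a * t) - b * F' (b * t)) t := fun t ht =>
    ((hcomp hF (by positivity) ht).sub (hcomp hF ha ht)).sub (hcomp hF hb ht)
  refine convexOn_of_hasDerivWithinAt2_nonneg (convex_Ici 0)
    (f'' := fun t => (a + b) * ((a + b) * F'' ((a + b) * t)) - a * (a * F'' (a * t)) -
      b * (b * F'' (b * t)))
    (fun x hx => (hd x hx).continuousAt.continuousWithinAt)
    (fun x hx => (hd x (interior_subset hx)).hasDerivWithinAt)
    (fun x hx => ?_) fun x hx => ?_
  · have hx : 0 ≤ x := interior_subset hx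
    exact ((((hcomp hF' (by positivity) hx).const_mul _).sub
      ((hcomp hF' ha hx).const_mul _)).sub ((hcomp hF' hb hx).const_mul _)).hasDerivWithinAt
  · rw [interior_Ici, Set.mem_Ioi] at hx
    have h1 := hmono (a := a * x) (b := (a + b) * x) (by simp; positivity) (by simp; positivity)
      (by nlinarith)
    have h2 := hmono (a := b * x) (b := (a + b) * x) (by simp; positivity) (by simp; positivity)
      (by nlinarith)
    have h3 := mul_le_mul_of_nonneg_left h1 ha
    have h4 := mul_le_mul_of_nonneg_left h2 hb
    simp only at h3 h4
    refine nonneg_of_mul_nonneg_right (b := _) (a := x) ?_ hx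
    linarith

/-- The function `x ↦ log Γ(1 + x)`. -/
noncomputable def logGammaOneAdd (x : ℝ) : ℝ := Real.log (Real.Gamma (1 + x))

lemma logGammaOneAdd_zero : logGammaOneAdd 0 = 0 := by simp [logGammaOneAdd]

lemma exp_logGammaOneAdd {x : ℝ} (hx : 0 ≤ x) :
    Real.exp (logGammaOneAdd x) = Real.Gamma (1 + x) :=
  Real.exp_log (Real.Gamma_pos_of_pos (by linarith))

lemma convexOn_logGammaOneAdd_add_mul_sub {a b : ℝ} (ha : 0 ≤ a) (hb : 0 ≤ b) :
    ConvexOn ℝ (Set.Ici 0) fun t =>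
      logGammaOneAdd ((a + b) * t) - logGammaOneAdd (a * t) - logGammaOneAdd (b * t) := by
  set F : ℕ → ℝ → ℝ := fun n x =>
    Real.BohrMollerup.logGammaSeq (1 + x) n + 1 / ((n : ℝ) + 1) * (x ^ 2 / 2) with hFdef
  have hconv : ∀ n, ConvexOn ℝ (Set.Ici 0) fun t =>
      F n ((a + b) * t) - F n (a * t) - F n (b * t) := by
    intro n
    have hlin : ∀ (k : ℕ) (x : ℝ), HasDerivAt (fun x : ℝ => 1 + x + k) 1 x := fun k x =>
      ((hasDerivAt_id x).const_add 1).add_const (k : ℝ)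
    refine convexOn_comp_add_mul_sub
      (F' := fun x => Real.log n - ∑ k ∈ range (n + 1), 1 / (1 + x + k) + 1 / ((n : ℝ) + 1) * x)
      (F'' := fun x => (∑ k ∈ range (n + 1), 1 / (1 + x + k) ^ 2) + 1 / ((n : ℝ) + 1))
      (fun x hx => ?_) (fun x hx => ?_) (monotoneOn_mul_sum_one_div_sq n) ha hb
    · have h1 : ∀ k ∈ range (n + 1),
          HasDerivAt (fun x : ℝ => Real.log (1 + x + k)) (1 / (1 + x + k)) x := fun k _ =>
        (hlin k x).log (by positivity)
      have h2 : HasDerivAt (fun x : ℝ => (1 + x) * Real.log n + Real.log n.factorial)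
          (Real.log n) x := by
        simpa using (((hasDerivAt_id x).const_add 1).mul_const (Real.log n)).add_const
          (Real.log n.factorial)
      have h3 : HasDerivAt (fun x : ℝ => 1 / ((n : ℝ) + 1) * (x ^ 2 / 2))
          (1 / ((n : ℝ) + 1) * x) x :=
        (((hasDerivAt_pow 2 x).div_const 2).const_mul _).congr_deriv (by simp)
      exact (h2.sub (HasDerivAt.fun_sum h1)).add h3
    · have h1 : ∀ k ∈ range (n + 1),
          HasDerivAt (fun x : ℝ => 1 / (1 + x + k)) (-(1 / (1 + x + k) ^ 2)) x := by
        intro k _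
        have := (hlin k x).inv (by positivity)
        simpa [neg_div] using! this
      have h3 : HasDerivAt (fun x : ℝ => 1 / ((n : ℝ) + 1) * x) (1 / ((n : ℝ) + 1)) x := by
        simpa using (hasDerivAt_id x).const_mul (1 / ((n : ℝ) + 1))
      refine (((HasDerivAt.fun_sum h1).const_sub (Real.log n)).add h3).congr_deriv ?_
      simp
  have hlim : ∀ x, 0 ≤ x → Tendsto (fun n => F n x) atTop (nhds (logGammaOneAdd x)) := by
    intro x hx
    simpa [hFdef] using! (Real.BohrMollerup.tendsto_log_gamma (show 0 < 1 + x by linarith)).add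
      ((tendsto_one_div_add_atTop_nhds_zero_nat (𝕜 := ℝ)).mul_const (x ^ 2 / 2))
  have hlim' : ∀ t ∈ Set.Ici (0 : ℝ), Tendsto
      (fun n => F n ((a + b) * t) - F n (a * t) - F n (b * t)) atTop (nhds
        (logGammaOneAdd ((a + b) * t) - logGammaOneAdd (a * t) - logGammaOneAdd (b * t))) := by
    intro t ht
    have ht : 0 ≤ t := ht
    exact ((hlim _ (by positivity)).sub (hlim _ (by positivity))).sub (hlim _ (by positivity))
  refine ⟨convex_Ici 0, fun x hx y hy u v hu hv huv => ?_⟩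
  exact le_of_tendsto_of_tendsto' (hlim' _ (convex_Ici (0 : ℝ) hx hy hu hv huv))
    (((hlim' x hx).const_smul u).add ((hlim' y hy).const_smul v))
    fun n => (hconv n).2 hx hy hu hv huv

lemma convexOn_logGammaOneAdd_sum_mul_sub {ι : Type*} (s : Finset ι) {c : ι → ℝ}
    (hc : ∀ i, 0 ≤ c i) :
    ConvexOn ℝ (Set.Ici 0) fun t =>
      logGammaOneAdd ((∑ i ∈ s, c i) * t) - ∑ i ∈ s, logGammaOneAdd (c i * t) := by
  classical
  induction s using Finset.induction_on with
  | empty => simpa using convexOn_const _ (convex_Ici 0)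
  | insert i s hi ih =>
    simp only [sum_insert hi]
    refine ((convexOn_logGammaOneAdd_add_mul_sub (hc i)
      (sum_nonneg fun j (_ : j ∈ s) => hc j)).add ih).congr fun t _ => ?_
    simp only [Pi.add_apply]
    ring

lemma strictConvexOn_logGammaOneAdd : StrictConvexOn ℝ (Set.Ici 0) logGammaOneAdd := by
  have h1 : ConvexOn ℝ (Set.Ici 0) fun x : ℝ => Real.log (Real.Gamma (2 + x)) :=
    (Real.convexOn_log_Gamma.translate_right 2).subset
      (fun x (hx : 0 ≤ x) => by simp; linarith) (convex_Ici 0)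
  have h2 : StrictConcaveOn ℝ (Set.Ici 0) fun x : ℝ => Real.log (1 + x) :=
    (strictConcaveOn_log_Ioi.translate_right 1).subset
      (fun x (hx : 0 ≤ x) => by simp; linarith) (convex_Ici 0)
  refine (h1.sub_strictConcaveOn h2).congr fun x hx => ?_
  have hx : 0 < 1 + x := by have : 0 ≤ x := hx; linarith
  have : (2 + x) = (1 + x) + 1 := by ring
  simp only [logGammaOneAdd, Pi.sub_apply]
  rw [this, Real.Gamma_add_one hx.ne', Real.log_mul hx.ne' (Real.Gamma_pos_of_pos hx).ne']
  ring

lemma hasDerivAt_logGammaOneAdd_zero :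
    HasDerivAt logGammaOneAdd (-Real.eulerMascheroniConstant) 0 := by
  have h : HasDerivAt Real.Gamma (-Real.eulerMascheroniConstant) (1 + 0) := by
    simpa using Real.hasDerivAt_Gamma_one
  have := (h.comp_const_add 1 0).log (by simp)
  simpa using! this

lemma continuousOn_logGammaOneAdd : ContinuousOn logGammaOneAdd (Set.Ici 0) := by
  intro x hx
  have hx : 0 ≤ x := hx
  have h1 : 0 < 1 + x := by linarith
  have h : ContinuousAt Real.Gamma (1 + x) :=
    (Real.differentiableAt_Gamma fun m => by
      have : (0 : ℝ) ≤ m := m.cast_nonneg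
      linarith).continuousAt
  exact ((ContinuousAt.comp (f := fun y => 1 + y) h (by fun_prop)).log
    (Real.Gamma_pos_of_pos h1).ne').continuousWithinAt

lemma tendsto_logGammaOneAdd_atTop : Tendsto logGammaOneAdd atTop atTop := by
  refine tendsto_atTop_mono' _ ?_ Real.tendsto_log_atTop
  filter_upwards [eventually_ge_atTop 2] with x hx
  have h0 : 0 < x := by linarith
  have h1 : 1 ≤ Real.Gamma x := by
    simpa [Real.Gamma_two] using
      Real.Gamma_strictMonoOn_Ici.monotoneOn (Set.self_mem_Ici (a := (2 : ℝ))) hx hx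
  refine Real.log_le_log h0 ?_
  rw [add_comm, Real.Gamma_add_one h0.ne']
  nlinarith

lemma ConvexOn.sum_le_apply_sum {ι : Type*} {F : ℝ → ℝ} (hF : ConvexOn ℝ (Set.Ici 0) F)
    (h0 : F 0 = 0) (s : Finset ι) {x : ι → ℝ} (hx : ∀ i, 0 ≤ x i) :
    ∑ i ∈ s, F (x i) ≤ F (∑ i ∈ s, x i) := by
  have hS : 0 ≤ ∑ i ∈ s, x i := sum_nonneg fun i _ => hx i
  rcases hS.eq_or_lt with hS | hS
  · have : ∀ i ∈ s, x i = 0 := (sum_eq_zero_iff_of_nonneg fun i _ => hx i).1 hS.symm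
    rw [← hS, h0, sum_eq_zero fun i hi => by rw [this i hi, h0]]
  · set S := ∑ i ∈ s, x i with hSdef
    have key : ∀ i ∈ s, F (x i) ≤ x i / S * F S := by
      intro i hi
      have hle : x i ≤ S := single_le_sum (fun j _ => hx j) hi
      have := hF.2 (Set.mem_Ici.2 hS.le) (Set.self_mem_Ici (a := (0 : ℝ)))
        (div_nonneg (hx i) hS.le) (sub_nonneg.2 ((div_le_one hS).2 hle))
        (add_sub_cancel (x i / S) 1)
      simpa [h0, hS.ne'] using this
    calc _ ≤ ∑ i ∈ s, x i / S * F S := sum_le_sum key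
      _ = F S := by rw [← sum_mul, ← sum_div, div_self hS.ne', one_mul]

lemma StrictConvexOn.strictAntiOn_and_strictMonoOn {g : ℝ → ℝ}
    (hg : StrictConvexOn ℝ (Set.Ici 0) g) {t₀ : ℝ} (ht₀ : 0 < t₀)
    (hmin : ∀ t, 0 ≤ t → g t₀ ≤ g t) :
    StrictAntiOn g (Set.Icc 0 t₀) ∧ StrictMonoOn g (Set.Ici t₀) := by
  constructor
  · intro x hx y hy hxy
    rcases hy.2.eq_or_lt with rfl | hy'
    · refine (hmin x hx.1).lt_of_ne fun h => ?_
      exact hxy.ne' (hg.eq_of_isMinOn (fun t ht => hmin t ht) (fun t ht => h ▸ hmin t ht)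
        ht₀.le hx.1)
    · have := hg.lt_on_openSegment (x := x) (y := t₀) hx.1 ht₀.le (hxy.trans hy').ne
        ((openSegment_eq_Ioo (hxy.trans hy')).ge ⟨hxy, hy'⟩)
      rwa [max_eq_left (hmin x hx.1)] at this
  · intro x hx y hy hxy
    have hx : t₀ ≤ x := hx
    have hy0 : 0 ≤ y := ht₀.le.trans hy
    rcases hx.eq_or_lt with rfl | hx'
    · refine (hmin y hy0).lt_of_ne fun h => ?_
      exact hxy.ne (hg.eq_of_isMinOn (fun t ht => hmin t ht) (fun t ht => h ▸ hmin t ht)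
        ht₀.le hy0)
    · have := hg.lt_on_openSegment (x := t₀) (y := y) ht₀.le hy0 (hx'.trans hxy).ne
        ((openSegment_eq_Ioo (hx'.trans hxy)).ge ⟨hx', hxy⟩)
      rwa [max_eq_right (hmin y hy0)] at this

lemma exists_pos_forall_le {g : ℝ → ℝ} (hcont : ContinuousOn g (Set.Ici 0))
    (htop : Tendsto g atTop atTop) {g' : ℝ} (hd : HasDerivAt g g' 0) (hg' : g' < 0) :
    ∃ t₀, 0 < t₀ ∧ ∀ t, 0 ≤ t → g t₀ ≤ g t := by
  obtain ⟨s, hs0, hs⟩ : ∃ s, 0 < s ∧ g s < g 0 := by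
    have h := hasDerivAt_iff_tendsto_slope_zero.1 hd
    have h2 := (h.mono_left (nhdsGT_le_nhdsNE 0)).eventually (gt_mem_nhds hg')
    obtain ⟨s, hs, hs0⟩ := (h2.and self_mem_nhdsWithin).exists
    have hs0 : 0 < s := hs0
    refine ⟨s, hs0, ?_⟩
    simp only [zero_add, smul_eq_mul] at hs
    exact sub_neg.1 (neg_of_mul_neg_right hs (inv_nonneg.2 hs0.le))
  obtain ⟨T, hT⟩ := eventually_atTop.1 (htop.eventually_ge_atTop (g 0))
  obtain ⟨t₀, ht₀, hmin⟩ := (isCompact_Icc (a := (0 : ℝ)) (b := max s T)).exists_isMinOn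
    ⟨s, hs0.le, le_max_left _ _⟩ (hcont.mono Set.Icc_subset_Ici_self)
  have hs' : g t₀ ≤ g s := hmin ⟨hs0.le, le_max_left _ _⟩
  refine ⟨t₀, ht₀.1.lt_of_ne fun h => ?_, fun t ht => ?_⟩
  · rw [← h] at hs'
    linarith
  · rcases le_total t (max s T) with h | h
    · exact hmin ⟨ht, h⟩
    · exact (hs'.trans hs.le).trans (hT t ((le_max_right _ _).trans h))

lemma StrictConvexOn.finset_sum {ι : Type*} {s : Finset ι} (hs : s.Nonempty) {D : Set ℝ}
    {F : ι → ℝ → ℝ} (hF : ∀ i ∈ s, StrictConvexOn ℝ D (F i)) :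
    StrictConvexOn ℝ D fun x => ∑ i ∈ s, F i x := by
  obtain ⟨i, hi⟩ := hs
  refine ⟨(hF i hi).1, fun x hx y hy hxy a b ha hb hab => ?_⟩
  simp only [smul_sum, ← sum_add_distrib]
  exact sum_lt_sum_of_nonempty ⟨i, hi⟩ fun j hj => (hF j hj).2 hx hy hxy ha hb hab

lemma ConvexOn.finset_sum {ι : Type*} {s : Finset ι} {D : Set ℝ} (hD : Convex ℝ D)
    {F : ι → ℝ → ℝ} (hF : ∀ i ∈ s, ConvexOn ℝ D (F i)) :
    ConvexOn ℝ D fun x => ∑ i ∈ s, F i x := by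
  refine ⟨hD, fun x hx y hy a b ha hb hab => ?_⟩
  simp only [smul_sum, ← sum_add_distrib]
  exact sum_le_sum fun j hj => (hF j hj).2 hx hy ha hb hab

lemma strictConvexOn_logGammaOneAdd_mul {c : ℝ} (hc : 0 < c) :
    StrictConvexOn ℝ (Set.Ici 0) fun t => logGammaOneAdd (c * t) := by
  refine ⟨convex_Ici 0, fun x hx y hy hxy a b ha hb hab => ?_⟩
  have hx : 0 ≤ x := hx
  have hy : 0 ≤ y := hy
  have := strictConvexOn_logGammaOneAdd.2 (Set.mem_Ici.2 (mul_nonneg hc.le hx))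
    (Set.mem_Ici.2 (mul_nonneg hc.le hy)) (fun h => hxy (mul_left_cancel₀ hc.ne' h)) ha hb hab
  have e : c * (a • x + b • y) = a • (c * x) + b • (c * y) := by simp only [smul_eq_mul]; ring
  simpa only [e] using this

lemma hasDerivAt_logGammaOneAdd_mul_zero (c : ℝ) :
    HasDerivAt (fun t => logGammaOneAdd (c * t)) (c * -Real.eulerMascheroniConstant) 0 := by
  have h : HasDerivAt logGammaOneAdd (-Real.eulerMascheroniConstant) (c * 0) := by
    simpa using hasDerivAt_logGammaOneAdd_zero
  exact (h.comp 0 ((hasDerivAt_id 0).const_mul c)).congr_deriv (by ring)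

lemma continuousOn_logGammaOneAdd_mul {c : ℝ} (hc : 0 ≤ c) :
    ContinuousOn (fun t => logGammaOneAdd (c * t)) (Set.Ici 0) :=
  continuousOn_logGammaOneAdd.comp (by fun_prop) fun _ ht => mul_nonneg hc ht

theorem ratio_gamma_rho_lt_two_unique_minimum
    (m n : ℕ) (hm : 0 < m) (hn : 0 < n)
    (lam : Fin m → Fin n → ℝ) (hlam : ∀ i j, 0 < lam i j)
    (α : Fin m → ℝ) (hα : ∀ i, α i = ∑ j : Fin n, lam i j)
    (β : Fin n → ℝ) (hβ : ∀ j, β j = ∑ i : Fin m, lam i j)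
    (ρ : ℝ) (hρ : ρ < 2)
    (f : ℝ → ℝ)
    (hf : ∀ t, f t =
      ((∏ i : Fin m, Real.Gamma (1 + α i * t)) * ∏ j : Fin n, Real.Gamma (1 + β j * t)) /
        (∏ i : Fin m, ∏ j : Fin n, Real.Gamma (1 + lam i j * t)) ^ ρ) :
    Tendsto f (nhdsWithin 0 (Set.Ioi 0)) (nhds 1) ∧
      Tendsto f atTop atTop ∧
      ∃ t₀ : ℝ, 0 < t₀ ∧
        (∀ t : ℝ, 0 < t → f t₀ ≤ f t) ∧
        StrictAntiOn f (Set.Ioc 0 t₀) ∧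
        StrictMonoOn f (Set.Ici t₀) ∧
        ∀ t₁ : ℝ, 0 < t₁ → (∀ t : ℝ, 0 < t → f t₁ ≤ f t) → t₁ = t₀ := by
  have : Nonempty (Fin m) := ⟨⟨0, hm⟩⟩
  have : Nonempty (Fin n) := ⟨⟨0, hn⟩⟩
  have hα0 : ∀ i, 0 ≤ α i := fun i => hα i ▸ sum_nonneg fun j _ => (hlam i j).le
  have hβ0 : ∀ j, 0 ≤ β j := fun j => hβ j ▸ sum_nonneg fun i _ => (hlam i j).le
  set L := logGammaOneAdd with hL
  set R : ℝ → ℝ := fun t => ∑ i, (L (α i * t) - ∑ j, L (lam i j * t)) with hR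
  set C : ℝ → ℝ := fun t => ∑ j, (L (β j * t) - ∑ i, L (lam i j * t)) with hC
  set P : ℝ → ℝ := fun t => ∑ i, ∑ j, L (lam i j * t) with hP
  set g : ℝ → ℝ := fun t => R t + C t + (2 - ρ) * P t with hg
  have hfg : ∀ t, 0 ≤ t → f t = Real.exp (g t) := by
    intro t ht
    have hprod : ∀ {k : ℕ} (c : Fin k → ℝ), (∀ i, 0 ≤ c i) →
        ∏ i, Real.Gamma (1 + c i * t) = Real.exp (∑ i, L (c i * t)) := by
      intro k c hc
      rw [Real.exp_sum]
      exact prod_congr rfl fun i _ => (exp_logGammaOneAdd (mul_nonneg (hc i) ht)).symm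
    have hprod2 : ∏ i, ∏ j, Real.Gamma (1 + lam i j * t) = Real.exp (P t) := by
      rw [hP, Real.exp_sum]
      exact prod_congr rfl fun i _ => hprod _ fun j => (hlam i j).le
    rw [hf, hprod α hα0, hprod β hβ0, hprod2, ← Real.exp_mul, ← Real.exp_add, ← Real.exp_sub]
    congr 1
    simp only [hg, hR, hC, hP, sum_sub_distrib]
    rw [sum_comm (f := fun j i => L (lam i j * t))]
    ring
  have hcontL : ∀ {c : ℝ}, 0 ≤ c → ContinuousOn (fun t => L (c * t)) (Set.Ici 0) :=
    continuousOn_logGammaOneAdd_mul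
  have hlam0 : ∀ i j, 0 ≤ lam i j := fun i j => (hlam i j).le
  have hcont : ContinuousOn g (Set.Ici 0) := by
    exact ((continuousOn_finsetSum _ fun i _ => (hcontL (hα0 i)).sub
      (continuousOn_finsetSum _ fun j _ => hcontL (hlam0 i j))).add
      (continuousOn_finsetSum _ fun j _ => (hcontL (hβ0 j)).sub
      (continuousOn_finsetSum _ fun i _ => hcontL (hlam0 i j)))).add
      (continuousOn_const.mul (continuousOn_finsetSum _ fun i _ =>
        continuousOn_finsetSum _ fun j _ => hcontL (hlam0 i j)))
  have hg0 : g 0 = 0 := by simp [hg, hR, hC, hP, hL, logGammaOneAdd_zero]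
  have hconv : StrictConvexOn ℝ (Set.Ici 0) g := by
    have hRc : ConvexOn ℝ (Set.Ici 0) R := ConvexOn.finset_sum (convex_Ici 0) fun i _ => by
      simpa only [hα i] using convexOn_logGammaOneAdd_sum_mul_sub univ (hlam0 i)
    have hCc : ConvexOn ℝ (Set.Ici 0) C := ConvexOn.finset_sum (convex_Ici 0) fun j _ => by
      simpa only [hβ j] using convexOn_logGammaOneAdd_sum_mul_sub univ fun i => hlam0 i j
    have hPc : StrictConvexOn ℝ (Set.Ici 0) P :=
      StrictConvexOn.finset_sum univ_nonempty fun i _ =>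
        StrictConvexOn.finset_sum univ_nonempty fun j _ =>
          strictConvexOn_logGammaOneAdd_mul (hlam i j)
    refine (hRc.add hCc).add_strictConvexOn ⟨convex_Ici 0, fun x hx y hy hxy a b ha hb hab => ?_⟩
    have := mul_lt_mul_of_pos_left (hPc.2 hx hy hxy ha hb hab) (sub_pos.2 hρ)
    simp only [smul_eq_mul] at this ⊢
    linarith
  have hderiv : HasDerivAt g
      ((2 - ρ) * ∑ i, ∑ j, lam i j * -Real.eulerMascheroniConstant) 0 := by
    have hd : ∀ c : ℝ, HasDerivAt (fun t => L (c * t)) (c * -Real.eulerMascheroniConstant) 0 :=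
      hasDerivAt_logGammaOneAdd_mul_zero
    have hRd : HasDerivAt R 0 0 := by
      refine (HasDerivAt.fun_sum fun i _ => (hd (α i)).sub
        (HasDerivAt.fun_sum fun j _ => hd (lam i j))).congr_deriv ?_
      simp only [hα, ← sum_mul, sub_self, sum_const_zero]
    have hCd : HasDerivAt C 0 0 := by
      refine (HasDerivAt.fun_sum fun j _ => (hd (β j)).sub
        (HasDerivAt.fun_sum fun i _ => hd (lam i j))).congr_deriv ?_
      simp only [hβ, ← sum_mul, sub_self, sum_const_zero]
    have hPd : HasDerivAt P (∑ i, ∑ j, lam i j * -Real.eulerMascheroniConstant) 0 :=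
      HasDerivAt.fun_sum fun i _ => HasDerivAt.fun_sum fun j _ => hd (lam i j)
    exact ((hRd.add hCd).add (hPd.const_mul (2 - ρ))).congr_deriv (by simp)
  have hneg : (2 - ρ) * ∑ i, ∑ j, lam i j * -Real.eulerMascheroniConstant < 0 := by
    have hγ := Real.one_half_lt_eulerMascheroniConstant
    exact mul_neg_of_pos_of_neg (sub_pos.2 hρ) <| sum_neg (fun i _ => sum_neg
      (fun j _ => mul_neg_of_pos_of_neg (hlam i j) (by linarith)) univ_nonempty) univ_nonempty
  have hgtop : Tendsto g atTop atTop := by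
    have hLtop : ∀ i j, Tendsto (fun t => L (lam i j * t)) atTop atTop := fun i j =>
      tendsto_logGammaOneAdd_atTop.comp (tendsto_id.const_mul_atTop (hlam i j))
    have hev : ∀ᶠ t in atTop, ∀ i j, 0 ≤ L (lam i j * t) :=
      eventually_all.2 fun i => eventually_all.2 fun j => (hLtop i j).eventually_ge_atTop 0
    refine tendsto_atTop_mono' _ ?_
      ((hLtop ⟨0, hm⟩ ⟨0, hn⟩).const_mul_atTop (sub_pos.2 hρ))
    filter_upwards [hev, eventually_ge_atTop 0] with t ht ht0
    have hsup : ∀ {k : ℕ} (c : Fin k → ℝ), (∀ i, 0 ≤ c i) →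
        0 ≤ L ((∑ i, c i) * t) - ∑ i, L (c i * t) := by
      intro k c hc
      rw [sub_nonneg, sum_mul]
      exact strictConvexOn_logGammaOneAdd.convexOn.sum_le_apply_sum logGammaOneAdd_zero _
        fun i => mul_nonneg (hc i) ht0
    have h1 : 0 ≤ R t := sum_nonneg fun i _ => by simpa only [hα i] using hsup _ (hlam0 i)
    have h2 : 0 ≤ C t := sum_nonneg fun j _ => by
      simpa only [hβ j] using hsup _ fun i => hlam0 i j
    have h3 : L (lam ⟨0, hm⟩ ⟨0, hn⟩ * t) ≤ P t :=
      (single_le_sum (f := fun j => L (lam ⟨0, hm⟩ j * t)) (fun j _ => ht _ j)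
        (mem_univ _)).trans
      (single_le_sum (f := fun i => ∑ j, L (lam i j * t))
        (fun i _ => sum_nonneg fun j _ => ht i j) (mem_univ _))
    have h4 := mul_le_mul_of_nonneg_left h3 (sub_pos.2 hρ).le
    simp only [hg]
    linarith
  obtain ⟨t₀, ht₀, hmin⟩ := exists_pos_forall_le hcont hgtop hderiv hneg
  obtain ⟨hanti, hmono⟩ := hconv.strictAntiOn_and_strictMonoOn ht₀ hmin
  refine ⟨?_, ?_, t₀, ht₀, fun t ht => ?_, fun x hx y hy hxy => ?_, fun x hx y hy hxy => ?_,
    fun t₁ ht₁ h => ?_⟩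
  · have h1 : Tendsto g (nhdsWithin 0 (Set.Ioi 0)) (nhds 0) := by
      have := (hcont 0 Set.self_mem_Ici).mono Set.Ioi_subset_Ici_self
      rwa [ContinuousWithinAt, hg0] at this
    have h2 := (Real.continuous_exp.tendsto 0).comp h1
    rw [Real.exp_zero] at h2
    refine h2.congr' ?_
    filter_upwards [self_mem_nhdsWithin] with t ht using (hfg t (le_of_lt ht)).symm
  · refine (Real.tendsto_exp_atTop.comp hgtop).congr' ?_
    filter_upwards [eventually_ge_atTop 0] with t ht using (hfg t ht).symm
  · rw [hfg _ ht₀.le, hfg _ ht.le]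
    exact Real.exp_le_exp.2 (hmin t ht.le)
  · rw [hfg _ hx.1.le, hfg _ hy.1.le]
    exact Real.exp_lt_exp.2 (hanti (Set.Ioc_subset_Icc_self hx) (Set.Ioc_subset_Icc_self hy) hxy)
  · rw [hfg _ (ht₀.le.trans hx), hfg _ (ht₀.le.trans hy)]
    exact Real.exp_lt_exp.2 (hmono hx hy hxy)
  · have h1 := h t₀ ht₀
    rw [hfg _ ht₀.le, hfg _ ht₁.le, Real.exp_le_exp] at h1
    exact hconv.eq_of_isMinOn (fun t ht => h1.trans (hmin t ht)) (fun t ht => hmin t ht)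
      ht₁.le ht₀.le
end

section
/- Let m, n be positive integers, λ_{ij} > 0 for 1 ≤ i ≤ m, 1 ≤ j ≤ n, let ℓ be a positive integer, θ_k ∈ (0,1) for 1 ≤ k ≤ ℓ with ∑_{k=1}^ℓ θ_k = 1, and y_k > 0 for 1 ≤ k ≤ ℓ; put s = ∑_{k=1}^ℓ θ_k y_k. For positive reals a_1,…,a_r define the (Gamma-function) multinomial coefficient C(a_1,…,a_r) = Γ(1+∑_{q=1}^r a_q) / ∏_{q=1}^r Γ(1+a_q). Then [∏_{j=1}^n C(λ_{1j}s, λ_{2j}s, …, λ_{mj}s)] / ∏_{k=1}^ℓ [∏_{j=1}^n C(λ_{1j}y_k, λ_{2j}y_k, …, λ_{mj}y_k)]^{θ_k} ≤ ∏_{k=1}^ℓ [∏_{i=1}^m C(λ_{i1}y_k, λ_{i2}y_k, …, λ_{in}y_k)]^{θ_k} / [∏_{i=1}^m C(λ_{i1}s, λ_{i2}s, …, λ_{in}s)]. -/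
open Finset

/-- The multinomial coefficient `Γ(1 + ∑ a_q) / ∏ Γ(1 + a_q)` generalized to real
arguments via the gamma function. -/
noncomputable def multinomialCoeff {r : ℕ} (a : Fin r → ℝ) : ℝ :=
  Real.Gamma (1 + ∑ q, a q) / ∏ q, Real.Gamma (1 + a q)

open Filter Topology

/-- Telescoping estimate for the derivative of `x ↦ ∑ k ∈ [1, n], x / (x + k) ^ 2`. -/
theorem telescoping_le_deriv_term {x y : ℝ} (hx : 0 ≤ x) (hy : 0 < y) :
    (1 / y + 1 / (2 * y ^ 2) - x * (1 / y ^ 2 + 1 / y ^ 3 + 1 / (2 * y ^ 4))) -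
      (1 / (y + 1) + 1 / (2 * (y + 1) ^ 2) -
        x * (1 / (y + 1) ^ 2 + 1 / (y + 1) ^ 3 + 1 / (2 * (y + 1) ^ 4))) ≤
      1 / y ^ 2 - x * (2 / y ^ 3) := by
  have h1 : 1 / y + 1 / (2 * y ^ 2) - (1 / (y + 1) + 1 / (2 * (y + 1) ^ 2)) ≤ 1 / y ^ 2 := by
    rw [← sub_nonneg]
    have : 1 / y ^ 2 - (1 / y + 1 / (2 * y ^ 2) - (1 / (y + 1) + 1 / (2 * (y + 1) ^ 2))) =
        1 / (2 * y ^ 2 * (y + 1) ^ 2) := by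
      field_simp
      ring
    rw [this]
    positivity
  have h2 : 2 / y ^ 3 ≤ 1 / y ^ 2 + 1 / y ^ 3 + 1 / (2 * y ^ 4) -
      (1 / (y + 1) ^ 2 + 1 / (y + 1) ^ 3 + 1 / (2 * (y + 1) ^ 4)) := by
    rw [← sub_nonneg]
    have : 1 / y ^ 2 + 1 / y ^ 3 + 1 / (2 * y ^ 4) -
        (1 / (y + 1) ^ 2 + 1 / (y + 1) ^ 3 + 1 / (2 * (y + 1) ^ 4)) - 2 / y ^ 3 =
        (2 * y + 1) / (2 * y ^ 4 * (y + 1) ^ 4) := by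
      field_simp
      ring
    rw [this]
    positivity
  have h3 := mul_le_mul_of_nonneg_left h2 hx
  linarith

theorem deriv_sum_lower_bound {x : ℝ} (hx : 0 ≤ x) (N : ℕ) :
    -(2 / (N + 1 : ℝ)) ≤
      ∑ k ∈ range N, (1 / (x + 1 + k) ^ 2 - x * (2 / (x + 1 + k) ^ 3)) := by
  set V : ℕ → ℝ := fun k => 1 / (x + 1 + k) + 1 / (2 * (x + 1 + k) ^ 2) -
    x * (1 / (x + 1 + k) ^ 2 + 1 / (x + 1 + k) ^ 3 + 1 / (2 * (x + 1 + k) ^ 4)) with hV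
  have htel : V 0 - V N ≤
      ∑ k ∈ range N, (1 / (x + 1 + k) ^ 2 - x * (2 / (x + 1 + k) ^ 3)) := by
    rw [← sum_range_sub']
    refine sum_le_sum fun k _ => ?_
    have := telescoping_le_deriv_term hx (y := x + 1 + k) (by positivity)
    simp only [hV]
    push_cast
    rwa [← add_assoc]
  have h0 : 0 ≤ V 0 := by
    have : V 0 = 1 / (2 * (x + 1) ^ 2) + 1 / (2 * (x + 1) ^ 3) + 1 / (2 * (x + 1) ^ 4) := by
      simp only [hV, Nat.cast_zero, add_zero]
      field_simp
      ring
    rw [this]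
    positivity
  have hN : V N ≤ 2 / (N + 1 : ℝ) := by
    have hy : (N + 1 : ℝ) ≤ x + 1 + N := by linarith
    have hN1 : (1 : ℝ) ≤ N + 1 := by linarith [(Nat.cast_nonneg N : (0 : ℝ) ≤ N)]
    have ha : 1 / (x + 1 + N) ≤ 1 / (N + 1 : ℝ) := one_div_le_one_div_of_le (by linarith) hy
    have hb : 1 / (2 * (x + 1 + N) ^ 2) ≤ 1 / (N + 1 : ℝ) :=
      one_div_le_one_div_of_le (by linarith) (by nlinarith)
    have hc : 0 ≤ x * (1 / (x + 1 + N) ^ 2 + 1 / (x + 1 + N) ^ 3 + 1 / (2 * (x + 1 + N) ^ 4)) := by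
      positivity
    have hd : 2 / (N + 1 : ℝ) = 1 / (N + 1 : ℝ) + 1 / (N + 1 : ℝ) := by ring
    simp only [hV]
    linarith
  linarith

/-- The quadratic term makes `x * φ''(x)` monotone; it vanishes in the limit `n → ∞`. -/
noncomputable def regLogGammaSeq (n : ℕ) (x : ℝ) : ℝ :=
  Real.BohrMollerup.logGammaSeq (1 + x) n + x ^ 2 / ((n + 1 : ℕ) + 1 : ℝ)

theorem tendsto_regLogGammaSeq {x : ℝ} (hx : 0 < x) :
    Tendsto (fun n => regLogGammaSeq n x) atTop (𝓝 (Real.log (Real.Gamma (1 + x)))) := by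
  have h1 := Real.BohrMollerup.tendsto_log_gamma (x := 1 + x) (by linarith)
  have h2 : Tendsto (fun n : ℕ => x ^ 2 / ((n + 1 : ℕ) + 1 : ℝ)) atTop (𝓝 0) :=
    (tendsto_const_div_atTop_nhds_zero_nat (x ^ 2)).comp (tendsto_add_atTop_nat 2) |>.congr
      fun n => by simp only [Function.comp]; push_cast; ring_nf
  simpa [regLogGammaSeq] using h1.add h2

theorem hasDerivAt_regLogGammaSeq (n : ℕ) {x : ℝ} (hx : 0 < x) :
    HasDerivAt (regLogGammaSeq n)
      (Real.log n - ∑ k ∈ range (n + 1), 1 / (x + 1 + k) + 2 * x / ((n + 1 : ℕ) + 1 : ℝ)) x := by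
  have hid := hasDerivAt_id' x
  have hsum : HasDerivAt (fun x : ℝ => ∑ k ∈ range (n + 1), Real.log (1 + x + k))
      (∑ k ∈ range (n + 1), 1 / (x + 1 + k)) x := by
    refine HasDerivAt.fun_sum fun k _ => ?_
    refine (((hid.const_add 1).add_const (k : ℝ)).log (by positivity)).congr_deriv ?_
    ring
  have hlin := (((hid.const_add 1).mul_const (Real.log n)).add_const (Real.log n.factorial)).sub hsum
  refine (hlin.add ((hid.pow 2).div_const ((n + 1 : ℕ) + 1 : ℝ))).congr_deriv ?_
  simp

theorem hasDerivAt_deriv_regLogGammaSeq (n : ℕ) {x : ℝ} (hx : 0 < x) :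
    HasDerivAt (fun x : ℝ =>
      Real.log n - ∑ k ∈ range (n + 1), 1 / (x + 1 + k) + 2 * x / ((n + 1 : ℕ) + 1 : ℝ))
      (∑ k ∈ range (n + 1), 1 / (x + 1 + k) ^ 2 + 2 / ((n + 1 : ℕ) + 1 : ℝ)) x := by
  have hid := hasDerivAt_id' x
  have hsum : HasDerivAt (fun x : ℝ => ∑ k ∈ range (n + 1), 1 / (x + 1 + k))
      (∑ k ∈ range (n + 1), -(1 / (x + 1 + k) ^ 2)) x := by
    refine HasDerivAt.fun_sum fun k _ => ?_
    simp only [one_div]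
    refine (((hid.add_const 1).add_const (k : ℝ)).fun_inv (by positivity)).congr_deriv ?_
    ring
  refine ((hsum.const_sub (Real.log n)).add
    ((hid.const_mul 2).div_const ((n + 1 : ℕ) + 1 : ℝ))).congr_deriv ?_
  simp [sum_neg_distrib]

theorem monotoneOn_mul_deriv2_regLogGammaSeq (n : ℕ) :
    MonotoneOn (fun x : ℝ =>
      x * (∑ k ∈ range (n + 1), 1 / (x + 1 + k) ^ 2 + 2 / ((n + 1 : ℕ) + 1 : ℝ)))
      (Set.Ioi 0) := by
  have hderiv : ∀ x ∈ Set.Ioi (0 : ℝ), HasDerivAt (fun x : ℝ =>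
      x * (∑ k ∈ range (n + 1), 1 / (x + 1 + k) ^ 2 + 2 / ((n + 1 : ℕ) + 1 : ℝ)))
      (∑ k ∈ range (n + 1), (1 / (x + 1 + k) ^ 2 - x * (2 / (x + 1 + k) ^ 3)) +
        2 / ((n + 1 : ℕ) + 1 : ℝ)) x := by
    intro x hx
    have hx : 0 < x := hx
    have hid := hasDerivAt_id' x
    have hsum : HasDerivAt (fun x : ℝ => ∑ k ∈ range (n + 1), 1 / (x + 1 + k) ^ 2)
        (∑ k ∈ range (n + 1), -(2 / (x + 1 + k) ^ 3)) x := by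
      refine HasDerivAt.fun_sum fun k _ => ?_
      have hne : x + 1 + k ≠ 0 := by positivity
      simp only [one_div]
      refine ((((hid.add_const 1).add_const (k : ℝ)).fun_pow 2).fun_inv
        (by positivity)).congr_deriv ?_
      field_simp
      norm_num [mul_comm]
    refine (hid.mul (hsum.add_const (2 / ((n + 1 : ℕ) + 1 : ℝ)))).congr_deriv ?_
    rw [sum_sub_distrib, sum_neg_distrib, ← mul_sum]
    ring
  refine monotoneOn_of_hasDerivWithinAt_nonneg (convex_Ioi 0)
    (fun x hx => (hderiv x hx).continuousAt.continuousWithinAt)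
    (fun x hx => (hderiv x (interior_subset hx)).hasDerivWithinAt) fun x hx => ?_
  have hx : x ∈ Set.Ioi (0 : ℝ) := interior_subset hx
  linarith [deriv_sum_lower_bound (le_of_lt hx) (n + 1)]

/-- If `x * φ''(x)` is monotone on `(0, ∞)`, then `t ↦ φ((∑ a) t) - ∑ φ(a t)` is convex there. -/
theorem convexOn_sum_sub_sum_of_monotoneOn_mul_deriv2 {ι : Type*} [Fintype ι] [Nonempty ι]
    {φ φ' φ'' : ℝ → ℝ}
    (h1 : ∀ x, 0 < x → HasDerivAt φ (φ' x) x) (h2 : ∀ x, 0 < x → HasDerivAt φ' (φ'' x) x)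
    (hmono : MonotoneOn (fun x => x * φ'' x) (Set.Ioi 0))
    {a : ι → ℝ} (ha : ∀ q, 0 < a q) :
    ConvexOn ℝ (Set.Ioi 0) (fun t => φ ((∑ q, a q) * t) - ∑ q, φ (a q * t)) := by
  have hA : 0 < ∑ q, a q := sum_pos (fun q _ => ha q) univ_nonempty
  have hscale (b t : ℝ) : HasDerivAt (fun t => b * t) b t := by
    simpa using (hasDerivAt_id' t).const_mul b
  have hd1 : ∀ t ∈ Set.Ioi (0 : ℝ), HasDerivAt
      (fun t => φ ((∑ q, a q) * t) - ∑ q, φ (a q * t))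
      (φ' ((∑ q, a q) * t) * (∑ q, a q) - ∑ q, φ' (a q * t) * a q) t := fun t ht =>
    ((h1 _ (mul_pos hA ht)).comp t (hscale _ t)).sub
      (HasDerivAt.fun_sum fun q _ => (h1 _ (mul_pos (ha q) ht)).comp t (hscale _ t))
  have hd2 : ∀ t ∈ Set.Ioi (0 : ℝ), HasDerivAt
      (fun t => φ' ((∑ q, a q) * t) * (∑ q, a q) - ∑ q, φ' (a q * t) * a q)
      (φ'' ((∑ q, a q) * t) * (∑ q, a q) * (∑ q, a q) - ∑ q, φ'' (a q * t) * a q * a q) t :=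
    fun t ht => (((h2 _ (mul_pos hA ht)).comp t (hscale _ t)).mul_const _).sub
      (HasDerivAt.fun_sum fun q _ =>
        ((h2 _ (mul_pos (ha q) ht)).comp t (hscale _ t)).mul_const _)
  refine convexOn_of_hasDerivWithinAt2_nonneg (convex_Ioi 0)
    (fun t ht => (hd1 t ht).continuousAt.continuousWithinAt)
    (fun t ht => (hd1 t (interior_subset ht)).hasDerivWithinAt)
    (fun t ht => (hd2 t (interior_subset ht)).hasDerivWithinAt) fun t ht => ?_
  have ht : 0 < t := interior_subset ht
  rw [sub_nonneg, mul_sum]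
  refine sum_le_sum fun q _ => ?_
  have hle : a q * t ≤ (∑ q, a q) * t :=
    mul_le_mul_of_nonneg_right (single_le_sum (fun q _ => (ha q).le) (mem_univ q)) ht.le
  have hq := hmono (mul_pos (ha q) ht) (mul_pos hA ht) hle
  refine mul_le_mul_of_nonneg_right ?_ (ha q).le
  refine le_of_mul_le_mul_right ?_ ht
  simp only at hq
  linarith

theorem convexOn_of_tendsto {s : Set ℝ} (hs : Convex ℝ s) {F : ℕ → ℝ → ℝ} {f : ℝ → ℝ}
    (hF : ∀ n, ConvexOn ℝ s (F n)) (hlim : ∀ x ∈ s, Tendsto (fun n => F n x) atTop (𝓝 (f x))) :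
    ConvexOn ℝ s f :=
  ⟨hs, fun _ hx _ hy a b ha hb hab =>
    le_of_tendsto_of_tendsto' (hlim _ (hs hx hy ha hb hab))
      (((hlim _ hx).const_smul a).add ((hlim _ hy).const_smul b))
      fun n => (hF n).2 hx hy ha hb hab⟩

theorem multinomialCoeff_pos {r : ℕ} {a : Fin r → ℝ} (ha : ∀ q, 0 < a q) :
    0 < multinomialCoeff a := by
  have hsum : 0 ≤ ∑ q, a q := sum_nonneg fun q _ => (ha q).le
  exact div_pos (Real.Gamma_pos_of_pos (by linarith))
    (prod_pos fun q _ => Real.Gamma_pos_of_pos (by linarith [ha q]))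

theorem convexOn_log_multinomialCoeff {r : ℕ} (hr : 0 < r) {a : Fin r → ℝ} (ha : ∀ q, 0 < a q) :
    ConvexOn ℝ (Set.Ioi 0) (fun t => Real.log (multinomialCoeff fun q => a q * t)) := by
  have : Nonempty (Fin r) := ⟨⟨0, hr⟩⟩
  have hA : 0 < ∑ q, a q := sum_pos (fun q _ => ha q) univ_nonempty
  refine convexOn_of_tendsto (convex_Ioi 0)
    (fun n => convexOn_sum_sub_sum_of_monotoneOn_mul_deriv2
      (fun x hx => hasDerivAt_regLogGammaSeq n hx)
      (fun x hx => hasDerivAt_deriv_regLogGammaSeq n hx)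
      (monotoneOn_mul_deriv2_regLogGammaSeq n) ha) fun t ht => ?_
  have ht : 0 < t := ht
  have hpos (q : Fin r) : 0 < Real.Gamma (1 + a q * t) :=
    Real.Gamma_pos_of_pos (by linarith [mul_pos (ha q) ht])
  have hposA : 0 < Real.Gamma (1 + (∑ q, a q) * t) :=
    Real.Gamma_pos_of_pos (by linarith [mul_pos hA ht])
  rw [multinomialCoeff, ← sum_mul, Real.log_div hposA.ne'
      (prod_ne_zero_iff.2 fun q _ => (hpos q).ne'),
    Real.log_prod fun q _ => (hpos q).ne']
  exact (tendsto_regLogGammaSeq (mul_pos hA ht)).sub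
    (tendsto_finsetSum _ fun q _ => tendsto_regLogGammaSeq (mul_pos (ha q) ht))

theorem multinomialCoeff_le_prod_rpow {r : ℕ} (hr : 0 < r) {a : Fin r → ℝ} (ha : ∀ q, 0 < a q)
    {ι : Type*} [Fintype ι] {θ y : ι → ℝ} (hθ : ∀ k, 0 ≤ θ k) (hθsum : ∑ k, θ k = 1)
    (hy : ∀ k, 0 < y k) :
    multinomialCoeff (fun q => a q * ∑ k, θ k * y k) ≤
      ∏ k, multinomialCoeff (fun q => a q * y k) ^ θ k := by
  have hs : 0 < ∑ k, θ k * y k := by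
    simpa using (convex_Ioi (0 : ℝ)).sum_mem (fun k _ => hθ k) hθsum fun k _ => hy k
  have hC (k : ι) : 0 < multinomialCoeff (fun q => a q * y k) :=
    multinomialCoeff_pos fun q => mul_pos (ha q) (hy k)
  have hP (k : ι) : 0 < multinomialCoeff (fun q => a q * y k) ^ θ k := Real.rpow_pos_of_pos (hC k) _
  rw [← Real.log_le_log_iff (multinomialCoeff_pos fun q => mul_pos (ha q) hs)
    (prod_pos fun k _ => hP k), Real.log_prod fun k _ => (hP k).ne']
  simp only [Real.log_rpow (hC _)]
  simpa using (convexOn_log_multinomialCoeff hr ha).map_sum_le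
    (fun k _ => hθ k) hθsum fun k _ => hy k

theorem prod_multinomialCoeff_le_prod_rpow {r c : ℕ} (hr : 0 < r) {a : Fin c → Fin r → ℝ}
    (ha : ∀ j q, 0 < a j q) {ι : Type*} [Fintype ι] {θ y : ι → ℝ} (hθ : ∀ k, 0 ≤ θ k)
    (hθsum : ∑ k, θ k = 1) (hy : ∀ k, 0 < y k) :
    ∏ j, multinomialCoeff (fun q => a j q * ∑ k, θ k * y k) ≤
      ∏ k, (∏ j, multinomialCoeff (fun q => a j q * y k)) ^ θ k := by
  have hs : 0 < ∑ k, θ k * y k := by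
    simpa using (convex_Ioi (0 : ℝ)).sum_mem (fun k _ => hθ k) hθsum fun k _ => hy k
  calc ∏ j, multinomialCoeff (fun q => a j q * ∑ k, θ k * y k)
      ≤ ∏ j, ∏ k, multinomialCoeff (fun q => a j q * y k) ^ θ k :=
        prod_le_prod (fun j _ => (multinomialCoeff_pos fun q => mul_pos (ha j q) hs).le)
          fun j _ => multinomialCoeff_le_prod_rpow hr (ha j) hθ hθsum hy
    _ = ∏ k, (∏ j, multinomialCoeff (fun q => a j q * y k)) ^ θ k := by
        rw [Finset.prod_comm]
        exact prod_congr rfl fun k _ => Real.finsetProd_rpow _ _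
          (fun j _ => (multinomialCoeff_pos fun q => mul_pos (ha j q) (hy k)).le) _

theorem multinomial_coeff_log_convexity_inequality
    (m n ℓ : ℕ) (hm : 0 < m) (hn : 0 < n) (hℓ : 0 < ℓ)
    (lam : Fin m → Fin n → ℝ) (hlam : ∀ i j, 0 < lam i j)
    (θ : Fin ℓ → ℝ) (hθ : ∀ k, θ k ∈ Set.Ioo (0 : ℝ) 1) (hθsum : ∑ k, θ k = 1)
    (y : Fin ℓ → ℝ) (hy : ∀ k, 0 < y k)
    (s : ℝ) (hs : s = ∑ k, θ k * y k) :
    (∏ j : Fin n, multinomialCoeff (fun i : Fin m => lam i j * s)) /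
        (∏ k : Fin ℓ,
          (∏ j : Fin n, multinomialCoeff (fun i : Fin m => lam i j * y k)) ^ θ k) ≤
      (∏ k : Fin ℓ,
          (∏ i : Fin m, multinomialCoeff (fun j : Fin n => lam i j * y k)) ^ θ k) /
        ∏ i : Fin m, multinomialCoeff (fun j : Fin n => lam i j * s) := by
  subst hs
  have hθ0 (k : Fin ℓ) : 0 ≤ θ k := (hθ k).1.le
  have hs : 0 < ∑ k, θ k * y k := by
    simpa using (convex_Ioi (0 : ℝ)).sum_mem (fun k _ => hθ0 k) hθsum fun k _ => hy k
  have hcol := prod_multinomialCoeff_le_prod_rpow hm (a := fun j i => lam i j)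
    (fun j i => hlam i j) hθ0 hθsum hy
  have hrow := prod_multinomialCoeff_le_prod_rpow hn hlam hθ0 hθsum hy
  have hcol_pos : 0 < ∏ j : Fin n, multinomialCoeff (fun i => lam i j * ∑ k, θ k * y k) :=
    prod_pos fun j _ => multinomialCoeff_pos fun i => mul_pos (hlam i j) hs
  have hrow_pos : 0 < ∏ i : Fin m, multinomialCoeff (fun j => lam i j * ∑ k, θ k * y k) :=
    prod_pos fun i _ => multinomialCoeff_pos fun j => mul_pos (hlam i j) hs
  exact ((div_le_one (hcol_pos.trans_le hcol)).2 hcol).trans ((one_le_div hrow_pos).2 hrow)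
end
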